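/- For partitions α, β of n and a composition ν of n, the number lr(α,β;ν) of pairs (T,S) of Littlewood-Richardson multitableaux of shapes α and β respectively, both of type ν and with the same content, equals the inner product ⟨χ^α ⊗ χ^β ⊗ φ^ν, χ^(n)⟩. -/

import Mathlib

open Finset Equiv
open scoped Classical

noncomputable section

/-- Value at `g` of the permutation character of `S_n` induced from the trivial character of
the Young subgroup of the composition `c`: the number of colorings of `Fin n` with fiber
sizes given by `c` that are fixed by `g`. -/
def permChar (n : ℕ) (c : ℕ → ℕ) (g : Perm (Fin n)) : ℚ :=
  Nat.card {f : Fin n → ℕ // (∀ k, Nat.card {x : Fin n // f x = k} = c k) ∧ ∀ x, f (g x) = f x}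

/-- Inner product of class functions (real-valued characters) of `S_n`. -/
def innerChar (n : ℕ) (χ ψ : Perm (Fin n) → ℚ) : ℚ :=
  (∑ g : Perm (Fin n), χ g * ψ g) / (n.factorial : ℚ)

/-- The trivial character `χ^{(n)}` of `S_n`. -/
def trivChar (n : ℕ) : Perm (Fin n) → ℚ := fun _ => 1

/-- The sign character `χ^{(1^n)}` of `S_n`. -/
def signChar (n : ℕ) : Perm (Fin n) → ℚ := fun g => ((Perm.sign g : ℤ) : ℚ)

/-- Permutation character for an integer vector: zero if some entry is negative. -/
def permCharZ (n : ℕ) (c : ℕ → ℤ) (g : Perm (Fin n)) : ℚ :=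
  if ∀ k, 0 ≤ c k then permChar n (fun k => (c k).toNat) g else 0

/-- The irreducible character `χ^a` of `S_n` indexed by the partition `a`, given by the
Jacobi–Trudi determinantal formula `χ^a = ∑_σ sgn(σ) φ^{(a_i - i + σ(i))_i}`. -/
def irrChar (n : ℕ) (a : ℕ → ℕ) (g : Perm (Fin n)) : ℚ :=
  ∑ σ : Perm (Fin n), ((Perm.sign σ : ℤ) : ℚ) *
    permCharZ n (fun i => if h : i < n then (a i : ℤ) - i + ((σ ⟨i, h⟩ : Fin n) : ℕ) else 0) g

/-- Kronecker coefficient `k(a,b,c) = ⟨χ^a ⊗ χ^b, χ^c⟩`. -/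
def kron (n : ℕ) (a b c : ℕ → ℕ) : ℚ :=
  innerChar n (fun g => irrChar n a g * irrChar n b g) (irrChar n c)

/-- Extend a vector indexed by `Fin p` to `ℕ` by zeros. -/
def extc {p : ℕ} (l : Fin p → ℕ) : ℕ → ℕ := fun i => if h : i < p then l ⟨i, h⟩ else 0

/-- Dominance order: `a ⊵ b`. -/
def Dominates (a b : ℕ → ℕ) : Prop :=
  ∀ k, ∑ i ∈ Finset.range k, b i ≤ ∑ i ∈ Finset.range k, a i

/-- Conjugate (transpose) of a partition with at most `n` parts. -/
def conjFun (n : ℕ) (a : ℕ → ℕ) : ℕ → ℕ :=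
  fun j => ((Finset.range n).filter (fun i => j < a i)).card

/-- `a` is a partition of `n` (weakly decreasing, supported on the first `n` parts). -/
def IsPartitionFun (n : ℕ) (a : ℕ → ℕ) : Prop :=
  (∀ i j, i ≤ j → a j ≤ a i) ∧ (∀ i, n ≤ i → a i = 0) ∧ ∑ i ∈ Finset.range n, a i = n

/-- The weakly decreasing sequence of parts of `P : Nat.Partition n`. -/
def pf {n : ℕ} (P : n.Partition) : ℕ → ℕ :=
  fun i => ((P.parts.sort (· ≤ ·)).reverse).getD i 0

/-- The parts of `P : Nat.Partition n` as a vector of length `n`. -/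
def pfin {n : ℕ} (P : n.Partition) : Fin n → ℕ := fun k => pf P k

/-- Number of cells of the skew shape `a/b` where the filling `T` has entry `k`. -/
def skewContent (a b : ℕ → ℕ) (T : ℕ → ℕ → ℕ) (k : ℕ) : ℕ :=
  Nat.card {p : ℕ × ℕ // b p.1 ≤ p.2 ∧ p.2 < a p.1 ∧ T p.1 p.2 = k}

/-- Number of cells of the skew shape `a/b`. -/
def skewSize (a b : ℕ → ℕ) : ℕ :=
  Nat.card {p : ℕ × ℕ // b p.1 ≤ p.2 ∧ p.2 < a p.1}

/-- `T` is a semistandard filling of the shape `a` (zero outside, rows weakly increasing,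
columns strictly increasing). -/
def IsSSYT (a : ℕ → ℕ) (T : ℕ → ℕ → ℕ) : Prop :=
  (∀ i j, a i ≤ j → T i j = 0) ∧
  (∀ i j₁ j₂, j₁ ≤ j₂ → j₂ < a i → T i j₁ ≤ T i j₂) ∧
  (∀ i₁ i₂ j, i₁ < i₂ → j < a i₂ → T i₁ j < T i₂ j)

/-- The Kostka number: the number of semistandard Young tableaux of shape `a`
and content `c`. -/
def kostka (a c : ℕ → ℕ) : ℕ :=
  Nat.card {T : ℕ → ℕ → ℕ // IsSSYT a T ∧ ∀ k, skewContent a (fun _ => 0) T k = c k}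

/-- Number of entries equal to `k` in the prefix of the (right-to-left, top-to-bottom)
reading word of `T` ending at position `(i,j)`. -/
def lrCount (a b : ℕ → ℕ) (T : ℕ → ℕ → ℕ) (i j k : ℕ) : ℕ :=
  Nat.card {p : ℕ × ℕ //
    (p.1 < i ∨ (p.1 = i ∧ j ≤ p.2)) ∧ b p.1 ≤ p.2 ∧ p.2 < a p.1 ∧ T p.1 p.2 = k}

/-- `T` is a Littlewood–Richardson skew tableau of shape `a/b`: semistandard and its
reverse reading word is a lattice word. -/
def IsLR (a b : ℕ → ℕ) (T : ℕ → ℕ → ℕ) : Prop :=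
  (∀ i j, ¬(b i ≤ j ∧ j < a i) → T i j = 0) ∧
  (∀ i j₁ j₂, b i ≤ j₁ → j₁ ≤ j₂ → j₂ < a i → T i j₁ ≤ T i j₂) ∧
  (∀ i₁ i₂ j, i₁ < i₂ → b i₁ ≤ j → j < a i₁ → b i₂ ≤ j → j < a i₂ → T i₁ j < T i₂ j) ∧
  (∀ i j k, lrCount a b T i j (k + 1) ≤ lrCount a b T i j k)

/-- A Littlewood–Richardson multitableau of shape `α` with `r` parts: a chain of
partitions `0 = α(0) ⊆ α(1) ⊆ ⋯ ⊆ α(r) = α` together with Littlewood–Richardson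
fillings of the successive skew shapes. -/
structure LRMultiF (r : ℕ) (α : ℕ → ℕ) where
  chain : Fin (r + 1) → ℕ → ℕ
  antitone : ∀ k i j, i ≤ j → chain k j ≤ chain k i
  zero : ∀ i, chain 0 i = 0
  last : ∀ i, chain (Fin.last r) i = α i
  mono : ∀ (k : Fin r) (i : ℕ), chain k.castSucc i ≤ chain k.succ i
  T : Fin r → ℕ → ℕ → ℕ
  lr : ∀ k : Fin r, IsLR (chain k.succ) (chain k.castSucc) (T k)

/-- Content of the `k`-th tableau of a Littlewood–Richardson multitableau. -/
def LRMultiF.cont {r : ℕ} {α : ℕ → ℕ} (M : LRMultiF r α) (k : Fin r) : ℕ → ℕ :=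
  skewContent (M.chain k.succ) (M.chain k.castSucc) (M.T k)

/-- Size of the `k`-th tableau of a Littlewood–Richardson multitableau. -/
def LRMultiF.size {r : ℕ} {α : ℕ → ℕ} (M : LRMultiF r α) (k : Fin r) : ℕ :=
  skewSize (M.chain k.succ) (M.chain k.castSucc)

/-- `LR(α,β;ν)`: pairs of Littlewood–Richardson multitableaux of shapes `α`, `β`,
type `ν`, with equal contents. -/
def LRPairs (r : ℕ) (α β : ℕ → ℕ) (ν : Fin r → ℕ) :=
  {TS : LRMultiF r α × LRMultiF r β //
    (∀ k, TS.1.size k = ν k) ∧ (∀ k, TS.2.size k = ν k) ∧ ∀ k, TS.1.cont k = TS.2.cont k}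

/-- `LR*(α,β;ν)`: pairs of Littlewood–Richardson multitableaux of shapes `α`, `β`,
type `ν`, with termwise conjugate contents. -/
def LRPairsStar (n r : ℕ) (α β : ℕ → ℕ) (ν : Fin r → ℕ) :=
  {TS : LRMultiF r α × LRMultiF r β //
    (∀ k, TS.1.size k = ν k) ∧ (∀ k, TS.2.size k = ν k) ∧
      ∀ k m, TS.2.cont k m = conjFun n (TS.1.cont k) m}

/-- `lr(α,β;ν)`. -/
def lrNum (r : ℕ) (α β : ℕ → ℕ) (ν : Fin r → ℕ) : ℕ := Nat.card (LRPairs r α β ν)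

/-- `lr*(α,β;ν)`. -/
def lrStarNum (n r : ℕ) (α β : ℕ → ℕ) (ν : Fin r → ℕ) : ℕ :=
  Nat.card (LRPairsStar n r α β ν)

/-- A semistandard Young tableau (of arbitrary partition shape). -/
structure SSYTP where
  shape : ℕ → ℕ
  T : ℕ → ℕ → ℕ
  antitone : ∀ i j, i ≤ j → shape j ≤ shape i
  finite : ∃ N, ∀ i, N ≤ i → shape i = 0
  ssyt : IsSSYT shape T

/-- Content of a semistandard Young tableau. -/
def SSYTP.cont (P : SSYTP) : ℕ → ℕ := skewContent P.shape (fun _ => 0) P.T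

/-- The multiset of entries of a matrix. -/
def entriesM {p q : ℕ} (A : Fin p → Fin q → ℕ) : Multiset ℕ :=
  (Finset.univ : Finset (Fin p × Fin q)).val.map (fun ij => A ij.1 ij.2)

/-- The π-sequence of `A` is the partition `ν` (the weakly decreasing rearrangement of
the entries of `A` is `ν`). -/
def HasPiSeq {p q : ℕ} (A : Fin p → Fin q → ℕ) {n : ℕ} (ν : n.Partition) : Prop :=
  (entriesM A).filter (· ≠ 0) = ν.parts

end

/-! ### Cancelling first violations -/

/-- If the elements with a violation, sorted by their first violation (least `k`, then greatest
`i`), are paired off with opposite signs, only the elements without violations contribute. -/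
theorem sum_eq_sum_filter_of_violations {ι : Type*} (S : Finset ι) (f : ι → ℤ)
    (V : ι → ℕ → ℕ → Prop) (n : ℕ) (hb : ∀ A ∈ S, ∀ k i, V A k i → i < n)
    (g : ℕ → ℕ → ι → ι)
    (hg : ∀ k i, ∀ A ∈ S, V A k i → (∀ k' < k, ∀ i', ¬ V A k' i') → (∀ i' > i, ¬ V A k i') →
      g k i A ∈ S ∧ (V (g k i A) k i ∧ (∀ k' < k, ∀ i', ¬ V (g k i A) k' i') ∧
        ∀ i' > i, ¬ V (g k i A) k i') ∧ g k i (g k i A) = A ∧ f (g k i A) = - f A) :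
    ∑ A ∈ S, f A = ∑ A ∈ S with (∀ k i, ¬ V A k i), f A := by
  let B : ι → ℕ × ℕ → Prop := fun A y =>
    V A y.1 y.2 ∧ (∀ k' < y.1, ∀ i', ¬ V A k' i') ∧ ∀ i' > y.2, ¬ V A y.1 i'
  have hex : ∀ A : ι, ∃ y : ℕ × ℕ, (A ∈ S ∧ ∃ k i, V A k i) → B A y := by
    intro A
    by_cases h : A ∈ S ∧ ∃ k i, V A k i
    · obtain ⟨hA, h⟩ := h
      let k := Nat.find h
      have hk : ∃ i, V A k i := Nat.find_spec h
      have hk' : ∀ k' < k, ¬ ∃ i, V A k' i := fun k' hk' => Nat.find_min h hk'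
      obtain ⟨i, hi⟩ := hk
      refine ⟨(k, Nat.findGreatest (V A k) n), fun _ => ⟨?_, ?_, ?_⟩⟩
      · exact Nat.findGreatest_spec (P := V A k) (hb A hA k i hi).le hi
      · intro k' h1 i' h2
        exact hk' k' h1 ⟨i', h2⟩
      · intro i' h1 h2
        exact Nat.findGreatest_is_greatest h1 (hb A hA k i' h2).le h2
    · exact ⟨(0, 0), fun h' => absurd h' h⟩
  choose p hp using hex
  have huniq : ∀ A y z, B A y → B A z → y = z := by
    rintro A ⟨k, i⟩ ⟨k', i'⟩ ⟨h1, h2, h3⟩ ⟨h1', h2', h3'⟩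
    have hk : k = k' := by
      rcases lt_trichotomy k k' with h | h | h
      · exact absurd h1 (h2' k h i)
      · exact h
      · exact absurd h1' (h2 k' h i')
    subst hk
    rcases lt_trichotomy i i' with h | h | h
    · exact absurd h1' (h3 i' h)
    · rw [h]
    · exact absurd h1 (h3' i h)
  rw [← Finset.sum_filter_add_sum_filter_not S (fun A => ∀ k i, ¬ V A k i)]
  rw [add_eq_left]
  set T := S.filter (fun A => ¬ ∀ k i, ¬ V A k i) with hT
  have memT : ∀ A, A ∈ T ↔ A ∈ S ∧ ∃ k i, V A k i := by
    intro A; simp [hT]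
  rw [← Finset.sum_fiberwise_of_maps_to (g := p) (t := T.image p)
    (fun A hA => mem_image_of_mem p hA)]
  refine Finset.sum_eq_zero fun y _ => ?_
  have memF : ∀ A, A ∈ T.filter (fun A => p A = y) ↔ A ∈ S ∧ B A y := by
    intro A
    rw [mem_filter, memT]
    constructor
    · rintro ⟨h, rfl⟩
      exact ⟨h.1, hp A h⟩
    · rintro ⟨h, h'⟩
      have h2 : A ∈ S ∧ ∃ k i, V A k i := ⟨h, y.1, y.2, h'.1⟩
      exact ⟨h2, huniq _ _ _ (hp A h2) h'⟩
  refine Finset.sum_involution (fun A _ => g y.1 y.2 A) ?_ ?_ ?_ ?_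
  · intro A hA
    obtain ⟨h1, h2⟩ := (memF A).1 hA
    rw [(hg y.1 y.2 A h1 h2.1 h2.2.1 h2.2.2).2.2.2]; ring
  · intro A hA hne heq
    obtain ⟨h1, h2⟩ := (memF A).1 hA
    have := (hg y.1 y.2 A h1 h2.1 h2.2.1 h2.2.2).2.2.2
    rw [heq] at this
    omega
  · intro A hA
    obtain ⟨h1, h2⟩ := (memF A).1 hA
    have := hg y.1 y.2 A h1 h2.1 h2.2.1 h2.2.2
    exact (memF _).2 ⟨this.1, this.2.1⟩
  · intro A hA
    obtain ⟨h1, h2⟩ := (memF A).1 hA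
    exact (hg y.1 y.2 A h1 h2.1 h2.2.1 h2.2.2).2.2.1

/-! ### Matrices, their margins, and the semistandard condition -/

/-- Matrices of natural numbers supported on `n × n`, with total sum `m`. -/
def mats (n m : ℕ) : Finset (ℕ × ℕ → ℕ) := piAntidiag (range n ×ˢ range n) m

def rowSum (n : ℕ) (A : ℕ × ℕ → ℕ) (i : ℕ) : ℕ := ∑ l ∈ range n, A (i, l)

def colSum (n : ℕ) (A : ℕ × ℕ → ℕ) (l : ℕ) : ℕ := ∑ i ∈ range n, A (i, l)

def transp (A : ℕ × ℕ → ℕ) : ℕ × ℕ → ℕ := fun p => A (p.2, p.1)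

/-- `part μ A k i` is the length of row `i` once the letters `< k` have been added to `μ`, where
`A (i, l)` is the number of letters `l` in row `i`. -/
def part (μ : ℕ → ℕ) (A : ℕ × ℕ → ℕ) (k i : ℕ) : ℕ := μ i + ∑ l ∈ range k, A (i, l)

/-- Some letter `k` of row `i + 1` is not below a smaller letter of row `i`. -/
def Violates (μ : ℕ → ℕ) (A : ℕ × ℕ → ℕ) (k i : ℕ) : Prop := part μ A k i < part μ A (k + 1) (i + 1)

/-- The row-weakly-increasing filling with `A (i, l)` letters `l` in row `i`, starting from the
partition `μ`, has strictly increasing columns. -/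
def Semistd (μ : ℕ → ℕ) (A : ℕ × ℕ → ℕ) : Prop := ∀ k i, ¬ Violates μ A k i

/-- `v + δ`, with `δ = (0, -1, -2, …)`. -/
def shift (v : ℕ → ℕ) : ℕ → ℤ := fun i => (v i : ℤ) - i

/-- `E` changes sign when adjacent coordinates among the first `n` are swapped. -/
def Alternating (n : ℕ) (E : (ℕ → ℤ) → ℤ) : Prop :=
  ∀ v k, k + 1 < n → E (v ∘ swap k (k + 1)) = - E v

theorem mem_mats {n m : ℕ} {A : ℕ × ℕ → ℕ} :
    A ∈ mats n m ↔ ∑ i ∈ range n, rowSum n A i = m ∧ ∀ i l, n ≤ i ∨ n ≤ l → A (i, l) = 0 := by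
  unfold mats rowSum
  rw [mem_piAntidiag, Finset.sum_product]
  refine and_congr Iff.rfl ⟨fun h i l hil => ?_, fun h p hp => ?_⟩
  · by_contra h0
    have := h _ h0
    simp only [mem_product, mem_range] at this
    omega
  · simp only [mem_product, mem_range]
    by_contra h0
    exact hp (h p.1 p.2 (by omega))

theorem sum_rowSum (n : ℕ) (A : ℕ × ℕ → ℕ) :
    ∑ i ∈ range n, rowSum n A i = ∑ l ∈ range n, colSum n A l := Finset.sum_comm

theorem rowSum_transp (n : ℕ) (A : ℕ × ℕ → ℕ) : rowSum n (transp A) = colSum n A := rfl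

theorem colSum_transp (n : ℕ) (A : ℕ × ℕ → ℕ) : colSum n (transp A) = rowSum n A := rfl

theorem transp_mem_mats {n m : ℕ} {A : ℕ × ℕ → ℕ} (h : A ∈ mats n m) : transp A ∈ mats n m := by
  rw [mem_mats] at h ⊢
  rw [sum_rowSum, colSum_transp]
  exact ⟨h.1, fun i l hil => h.2 l i hil.symm⟩

theorem rowSum_eq_zero {n m : ℕ} {A : ℕ × ℕ → ℕ} (h : A ∈ mats n m) {i : ℕ} (hi : n ≤ i) :
    rowSum n A i = 0 :=
  Finset.sum_eq_zero fun l _ => (mem_mats.1 h).2 i l (Or.inl hi)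

theorem colSum_eq_zero {n m : ℕ} {A : ℕ × ℕ → ℕ} (h : A ∈ mats n m) {l : ℕ} (hl : n ≤ l) :
    colSum n A l = 0 :=
  rowSum_eq_zero (transp_mem_mats h) hl

@[simp] theorem part_zero (μ : ℕ → ℕ) (A : ℕ × ℕ → ℕ) (i : ℕ) : part μ A 0 i = μ i := by
  simp [part]

theorem part_succ (μ : ℕ → ℕ) (A : ℕ × ℕ → ℕ) (k i : ℕ) :
    part μ A (k + 1) i = part μ A k i + A (i, k) := by
  simp [part, Finset.sum_range_succ, add_assoc]

theorem part_eq (n : ℕ) (μ : ℕ → ℕ) (A : ℕ × ℕ → ℕ) (i : ℕ) :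
    part μ A n i = μ i + rowSum n A i := rfl

theorem part_congr {μ : ℕ → ℕ} {A B : ℕ × ℕ → ℕ} {k i : ℕ} (h : ∀ l < k, A (i, l) = B (i, l)) :
    part μ A k i = part μ B k i := by
  unfold part
  rw [Finset.sum_congr rfl fun l hl => h l (mem_range.1 hl)]

theorem part_mono (μ : ℕ → ℕ) (A : ℕ × ℕ → ℕ) (i : ℕ) : Monotone fun k => part μ A k i :=
  monotone_nat_of_le_succ fun k => by rw [part_succ]; omega

/-- Being a partition vanishing from `n` on. -/
def IsPart (n : ℕ) (μ : ℕ → ℕ) : Prop := Antitone μ ∧ ∀ i, n ≤ i → μ i = 0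

theorem part_eq_zero {n m : ℕ} {μ : ℕ → ℕ} (hμ : IsPart n μ) {A : ℕ × ℕ → ℕ} (h : A ∈ mats n m)
    (k : ℕ) {i : ℕ} (hi : n ≤ i) : part μ A k i = 0 := by
  unfold part
  rw [hμ.2 i hi, Finset.sum_eq_zero fun l _ => (mem_mats.1 h).2 i l (Or.inl hi), add_zero]

/-- Before the first violation, the shapes are partitions. -/
theorem part_succ_le_part {μ : ℕ → ℕ} (hμ : Antitone μ) {A : ℕ × ℕ → ℕ} {k : ℕ}
    (h : ∀ k' < k, ∀ i, ¬ Violates μ A k' i) (i : ℕ) : part μ A k (i + 1) ≤ part μ A k i := by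
  cases k with
  | zero => simpa using hμ (Nat.le_succ i)
  | succ k =>
    have h1 := h k (Nat.lt_succ_self k) i
    unfold Violates at h1
    have := part_succ μ A k i
    omega

theorem Violates.lt {n m : ℕ} {μ : ℕ → ℕ} (hμ : IsPart n μ) {A : ℕ × ℕ → ℕ} (h : A ∈ mats n m)
    {k i : ℕ} (hV : Violates μ A k i) : i + 1 < n := by
  by_contra hi
  unfold Violates at hV
  rw [part_eq_zero hμ h (k + 1) (i := i + 1) (by omega)] at hV
  omega

theorem Violates.lt_of_first {n m : ℕ} {μ : ℕ → ℕ} (hμ : IsPart n μ) {A : ℕ × ℕ → ℕ}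
    (h : A ∈ mats n m) {k i : ℕ} (hV : Violates μ A k i)
    (hk : ∀ k' < k, ∀ i, ¬ Violates μ A k' i) : k < n := by
  by_contra hn
  unfold Violates at hV
  rw [part_succ, (mem_mats.1 h).2 (i + 1) k (Or.inr (by omega))] at hV
  have := part_succ_le_part hμ.1 hk i
  omega

/-! ### Pieri cancellation -/

/-- The involution behind the Pieri rule, at letter `k` and rows `i, i + 1`. -/
def pieriFlip (μ : ℕ → ℕ) (k i : ℕ) (A : ℕ × ℕ → ℕ) : ℕ × ℕ → ℕ := fun p =>
  if p.2 < k then A p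
  else if p.2 = k then
    if p.1 = i then part μ A (k + 1) (i + 1) - 1 - part μ A k i
    else if p.1 = i + 1 then part μ A (k + 1) i + 1 - part μ A k (i + 1)
    else A p
  else A (swap i (i + 1) p.1, p.2)

theorem sum_range_pieriFlip {n : ℕ} (A A' : ℕ × ℕ → ℕ) (i l : ℕ) (hi : i + 1 < n)
    (h : ∀ r, r ≠ i → r ≠ i + 1 → A' (r, l) = A (r, l))
    (h2 : A' (i, l) + A' (i + 1, l) = A (i, l) + A (i + 1, l)) :
    colSum n A' l = colSum n A l := by
  unfold colSum
  have hs : ({i, i + 1} : Finset ℕ) ⊆ range n := by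
    intro x hx; simp at hx; simp; omega
  rw [← Finset.sum_sdiff hs, ← Finset.sum_sdiff (f := fun i => A (i, l)) hs,
    Finset.sum_pair (by omega), Finset.sum_pair (by omega), h2]
  congr 1
  refine Finset.sum_congr rfl fun r hr => ?_
  simp at hr
  exact h r (by tauto) (by tauto)

theorem sum_mats_eq_sum_semistd (n m : ℕ) {μ : ℕ → ℕ} (hμ : IsPart n μ)
    (Φ : (ℕ → ℤ) → (ℕ → ℕ) → ℤ) (hΦ : ∀ c, Alternating n fun v => Φ v c) :
    ∑ A ∈ mats n m, Φ (shift fun i => μ i + rowSum n A i) (colSum n A) =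
      ∑ A ∈ mats n m with Semistd μ A, Φ (shift fun i => μ i + rowSum n A i) (colSum n A) := by
  refine sum_eq_sum_filter_of_violations (mats n m) _ (Violates μ) n
    (fun A hA k i hV => by have := hV.lt hμ hA; omega) (pieriFlip μ) ?_
  intro k i A hA hV hk hi
  have hin := hV.lt hμ hA
  have hkn := hV.lt_of_first hμ hA hk
  have hp := part_succ_le_part hμ.1 hk i
  have hV' := hV
  unfold Violates at hV'
  have e1 := part_succ μ A k i
  have e2 := part_succ μ A k (i + 1)
  set A' := pieriFlip μ k i A with hA'
  have v1 : ∀ r l, l < k → A' (r, l) = A (r, l) := fun r l h => by simp [hA', pieriFlip, h]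
  have v2 : A' (i, k) = part μ A (k + 1) (i + 1) - 1 - part μ A k i := by simp [hA', pieriFlip]
  have v3 : A' (i + 1, k) = part μ A (k + 1) i + 1 - part μ A k (i + 1) := by
    simp [hA', pieriFlip]
  have v4 : ∀ r, r ≠ i → r ≠ i + 1 → A' (r, k) = A (r, k) := fun r h h' => by
    simp [hA', pieriFlip, h, h']
  have v5 : ∀ r l, k < l → A' (r, l) = A (swap i (i + 1) r, l) := fun r l h => by
    simp [hA', pieriFlip, h.ne', h.not_gt]
  have hcol : colSum n A' = colSum n A := by
    funext l
    refine sum_range_pieriFlip A A' i l hin ?_ ?_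
    · intro r h1 h2
      rcases lt_trichotomy l k with h | h | h
      · exact v1 r l h
      · rw [h]; exact v4 r h1 h2
      · rw [v5 r l h, swap_apply_of_ne_of_ne h1 h2]
    · rcases lt_trichotomy l k with h | h | h
      · rw [v1 _ l h, v1 _ l h]
      · rw [h, v2, v3]; omega
      · rw [v5 _ l h, v5 _ l h, swap_apply_left, swap_apply_right, add_comm]
  have hsupp : ∀ r l, n ≤ r ∨ n ≤ l → A' (r, l) = 0 := by
    intro r l hrl
    rcases lt_trichotomy l k with h | h | h
    · rw [v1 r l h]; exact (mem_mats.1 hA).2 r l hrl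
    · rw [h, v4 r (by omega) (by omega)]; exact (mem_mats.1 hA).2 r k (by omega)
    · rw [v5 r l h]
      rcases hrl with h' | h'
      · rw [swap_apply_of_ne_of_ne (by omega) (by omega)]
        exact (mem_mats.1 hA).2 r l (by omega)
      · exact (mem_mats.1 hA).2 _ l (by omega)
  have hmem : A' ∈ mats n m := by
    refine mem_mats.2 ⟨?_, hsupp⟩
    rw [sum_rowSum, hcol, ← sum_rowSum]
    exact (mem_mats.1 hA).1
  have pk : ∀ l ≤ k, ∀ r, part μ A' l r = part μ A l r := fun l hl r =>
    part_congr fun l' hl' => v1 r l' (by omega)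
  have pk1 : ∀ r, r ≠ i → r ≠ i + 1 → part μ A' (k + 1) r = part μ A (k + 1) r := fun r h h' => by
    rw [part_succ, part_succ, pk k le_rfl, v4 r h h']
  have pi : part μ A' (k + 1) i = part μ A (k + 1) (i + 1) - 1 := by
    rw [part_succ, pk k le_rfl, v2]; omega
  have pi1 : part μ A' (k + 1) (i + 1) = part μ A (k + 1) i + 1 := by
    rw [part_succ, pk k le_rfl, v3]; omega
  refine ⟨hmem, ⟨?_, ?_, ?_⟩, ?_, ?_⟩
  · unfold Violates
    rw [pi1, pk k le_rfl]; omega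
  · intro k' hk' i'
    have := hk k' hk' i'
    unfold Violates at this ⊢
    rw [pk _ (by omega), pk _ (by omega)]; exact this
  · intro i' hi'
    have := hi i' hi'
    unfold Violates at this ⊢
    rw [pk _ (by omega), pk1 _ (by omega) (by omega)]; exact this
  · funext ⟨r, l⟩
    unfold pieriFlip
    simp only
    rw [pi, pi1, pk k le_rfl, pk k le_rfl]
    split_ifs with h1 h2 h3 h4
    · exact v1 r l h1
    · subst h2 h3; omega
    · subst h2 h4; omega
    · subst h2; exact v4 r h3 h4
    · rw [v5 _ l (by omega), swap_apply_self]
  · rw [hcol]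
    have hv : (shift fun r => μ r + rowSum n A' r) =
        (shift fun r => μ r + rowSum n A r) ∘ swap i (i + 1) := by
      have tail : ∀ B : ℕ × ℕ → ℕ, ∀ r, μ r + rowSum n B r =
          part μ B (k + 1) r + ∑ l ∈ Ico (k + 1) n, B (r, l) := fun B r => by
        unfold rowSum part
        rw [← Finset.sum_range_add_sum_Ico (fun l => B (r, l)) (show k + 1 ≤ n by omega)]
        ring
      have ht : ∀ r, ∑ l ∈ Ico (k + 1) n, A' (r, l) =
          ∑ l ∈ Ico (k + 1) n, A (swap i (i + 1) r, l) := fun r =>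
        Finset.sum_congr rfl fun l hl => v5 r l (by simp at hl; omega)
      funext r
      simp only [shift, Function.comp]
      rw [tail A' r, ht, tail A]
      by_cases h1 : r = i
      · subst h1
        rw [swap_apply_left, pi]; push_cast; omega
      · by_cases h2 : r = i + 1
        · subst h2
          rw [swap_apply_right, pi1]; push_cast; omega
        · rw [swap_apply_of_ne_of_ne h1 h2, pk1 r h1 h2]
    rw [hv]
    exact hΦ _ _ i hin

/-! ### Littlewood–Richardson cancellation -/

/-- In row `r`, the largest end of the letters `≤ k` allowed by the neighbouring letters (and, in
row `i`, by the first lattice violation). -/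
def upperEnd (μ κ : ℕ → ℕ) (i k : ℕ) (A : ℕ × ℕ → ℕ) (r : ℕ) : ℕ :=
  if r = i then part μ A (k + 2) i - (part κ (transp A) i k + 1 - part κ (transp A) i (k + 1))
  else min (part μ A (k + 2) r) (part μ A k (r - 1))

/-- In row `r`, the smallest end of the letters `≤ k` allowed by the neighbouring letters. -/
def lowerEnd (μ : ℕ → ℕ) (k : ℕ) (A : ℕ × ℕ → ℕ) (r : ℕ) : ℕ :=
  max (part μ A (k + 2) (r + 1)) (part μ A k r)

def flippedEnd (μ κ : ℕ → ℕ) (i k : ℕ) (A : ℕ × ℕ → ℕ) (r : ℕ) : ℕ :=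
  upperEnd μ κ i k A r + lowerEnd μ k A r - part μ A (k + 1) r

/-- The Bender–Knuth involution on the letters `k, k + 1` beyond the lattice violation in
row `i`. -/
def latticeFlip (μ κ : ℕ → ℕ) (i k : ℕ) (A : ℕ × ℕ → ℕ) : ℕ × ℕ → ℕ := fun p =>
  if p.1 < i then A p
  else if p.2 = k then flippedEnd μ κ i k A p.1 - part μ A k p.1
  else if p.2 = k + 1 then part μ A (k + 2) p.1 - flippedEnd μ κ i k A p.1
  else A p

theorem sum_semistd_eq_sum_lattice (n m : ℕ) {μ κ : ℕ → ℕ} (hμ : IsPart n μ) (hκ : IsPart n κ)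
    (Φ : (ℕ → ℕ) → (ℕ → ℤ) → ℤ) (hΦ : ∀ c, Alternating n fun v => Φ c v) :
    ∑ A ∈ mats n m with Semistd μ A, Φ (rowSum n A) (shift fun l => κ l + colSum n A l) =
      ∑ A ∈ mats n m with Semistd μ A ∧ Semistd κ (transp A),
        Φ (rowSum n A) (shift fun l => κ l + colSum n A l) := by
  rw [← Finset.filter_filter]
  refine sum_eq_sum_filter_of_violations _ _ (fun A => Violates κ (transp A)) n
    (fun A hA k i hV => by
      have := hV.lt hκ (transp_mem_mats (mem_filter.1 hA).1); omega) (latticeFlip μ κ) ?_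
  intro i k A hAS hV hk hi
  obtain ⟨hA, hS⟩ := mem_filter.1 hAS
  have hAt := transp_mem_mats hA
  have hkn := hV.lt hκ hAt
  have hin := hV.lt_of_first hκ hAt hk
  have hp := part_succ_le_part hκ.1 hk k
  have hV' := hV
  unfold Violates at hV'
  have hQ : ∀ i l, part κ (transp A) (i + 1) l = part κ (transp A) i l + A (i, l) :=
    fun i l => part_succ κ (transp A) i l
  have hP := part_succ μ A
  have hP2 : ∀ r, part μ A (k + 2) r = part μ A (k + 1) r + A (r, k + 1) := hP (k + 1)
  have hSS : ∀ k i, part μ A (k + 1) (i + 1) ≤ part μ A k i := fun k i => not_lt.1 (hS k i)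
  rw [hQ] at hV'
  set d := part κ (transp A) i k + 1 - part κ (transp A) i (k + 1) with hd
  set U := upperEnd μ κ i k A with hU
  set Lo := lowerEnd μ k A with hLo
  set N := flippedEnd μ κ i k A with hN
  have Ui : U i = part μ A (k + 2) i - d := by simp [hU, upperEnd, hd]
  have Ur : ∀ r, r ≠ i → U r = min (part μ A (k + 2) r) (part μ A k (r - 1)) := fun r h => by
    simp [hU, upperEnd, h]
  have Lr : ∀ r, Lo r = max (part μ A (k + 2) (r + 1)) (part μ A k r) := fun r => rfl
  have Nr : ∀ r, N r = U r + Lo r - part μ A (k + 1) r := fun r => rfl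
  have hL : ∀ r, Lo r ≤ part μ A (k + 1) r := fun r => by
    rw [Lr]
    have h1 : part μ A (k + 2) (r + 1) ≤ _ := hSS (k + 1) r
    have h2 := hP k r
    simp only [max_le_iff]; omega
  have hU1 : ∀ r, i ≤ r → part μ A (k + 1) r ≤ U r := fun r hr => by
    by_cases h : r = i
    · subst h
      rw [Ui]
      have := hP2 r
      omega
    · rw [Ur r h]
      have h1 := hSS k (r - 1)
      rw [show r - 1 + 1 = r by omega] at h1
      have h2 := hP2 r
      simp only [le_min_iff]; omega
  have hU2 : ∀ r, i ≤ r → U r ≤ part μ A (k + 2) r := fun r hr => by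
    by_cases h : r = i
    · subst h; rw [Ui]; omega
    · rw [Ur r h]; exact min_le_left _ _
  have hU3 : ∀ r, i ≤ r + 1 → U (r + 1) ≤ part μ A k r := fun r hr => by
    by_cases h : r + 1 = i
    · rw [h, Ui]
      have hprev := hk r (by omega) k
      unfold Violates at hprev
      rw [h] at hprev
      have h1 : part μ A (k + 2) (r + 1) ≤ _ := hSS (k + 1) r
      rw [h] at h1
      have h2 := hP k r
      have h3 := hQ r k
      rw [h] at h3
      omega
    · rw [Ur _ h]; simp
  have hN1 : ∀ r, i ≤ r → N r ≤ U r := fun r hr => by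
    have h1 := hL r
    have h2 := hU1 r hr
    rw [Nr]; omega
  have hN2 : ∀ r, i ≤ r → Lo r ≤ N r := fun r hr => by
    have h1 := hL r
    have h2 := hU1 r hr
    rw [Nr]; omega
  have hLk : ∀ r, part μ A k r ≤ Lo r := fun r => by rw [Lr]; exact le_max_right _ _
  have hLk2 : ∀ r, part μ A (k + 2) (r + 1) ≤ Lo r := fun r => by rw [Lr]; exact le_max_left _ _
  set A' := latticeFlip μ κ i k A with hA'
  have v1 : ∀ r l, r < i → A' (r, l) = A (r, l) := fun r l h => by simp [hA', latticeFlip, h]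
  have v2 : ∀ r, i ≤ r → A' (r, k) = N r - part μ A k r := fun r h => by
    simp [hA', latticeFlip, h.not_gt, hN]
  have v3 : ∀ r, i ≤ r → A' (r, k + 1) = part μ A (k + 2) r - N r := fun r h => by
    simp [hA', latticeFlip, h.not_gt, hN]
  have v4 : ∀ r l, l ≠ k → l ≠ k + 1 → A' (r, l) = A (r, l) := fun r l h h' => by
    simp [hA', latticeFlip, h, h']
  have v23 : ∀ r, A' (r, k) + A' (r, k + 1) = A (r, k) + A (r, k + 1) := fun r => by
    by_cases h : r < i
    · rw [v1 r _ h, v1 r _ h]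
    · have h0 : i ≤ r := by omega
      rw [v2 r h0, v3 r h0]
      have h1 := hN1 r h0
      have h2 := hN2 r h0
      have h3 := hU2 r h0
      have h4 := hLk r
      have h5 := hP k r
      have h6 := hP2 r
      omega
  have hrow : rowSum n A' = rowSum n A := by
    funext r
    exact sum_range_pieriFlip (transp A) (transp A') k r hkn
      (fun l h1 h2 => v4 r l h1 h2) (v23 r)
  have hsupp : ∀ r l, n ≤ r ∨ n ≤ l → A' (r, l) = 0 := by
    intro r l hrl
    by_cases h1 : l = k
    · subst h1
      have h0 := v23 r
      rw [(mem_mats.1 hA).2 r l hrl, (mem_mats.1 hA).2 r (l + 1) (by omega)] at h0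
      omega
    by_cases h2 : l = k + 1
    · subst h2
      have h0 := v23 r
      rw [(mem_mats.1 hA).2 r k (by omega), (mem_mats.1 hA).2 r (k + 1) (by omega)] at h0
      omega
    · rw [v4 r l h1 h2]; exact (mem_mats.1 hA).2 r l hrl
  have hmem : A' ∈ mats n m := by
    refine mem_mats.2 ⟨?_, hsupp⟩
    rw [hrow]
    exact (mem_mats.1 hA).1
  have pl1 : ∀ l ≤ k, ∀ r, part μ A' l r = part μ A l r := fun l hl r =>
    part_congr fun l' hl' => v4 r l' (by omega) (by omega)
  have pk0 : ∀ r, r < i → part μ A' (k + 1) r = part μ A (k + 1) r := fun r hr =>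
    part_congr fun l' hl' => v1 r l' hr
  have pk1 : ∀ r, i ≤ r → part μ A' (k + 1) r = N r := fun r hr => by
    rw [part_succ, pl1 k le_rfl, v2 r hr]
    have h2 := hN2 r hr
    have h4 := hLk r
    omega
  have pl2 : ∀ l, k + 2 ≤ l → ∀ r, part μ A' l r = part μ A l r := by
    intro l hl r
    induction l, hl using Nat.le_induction with
    | base =>
      have h5 := hP k r
      have h6 := hP2 r
      have h7 := part_succ μ A' k r
      have h8 := part_succ μ A' (k + 1) r
      have h9 := pl1 k le_rfl r
      have h10 := v23 r
      have e : k + 1 + 1 = k + 2 := rfl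
      rw [e] at h8
      omega
    | succ l hl ih =>
      rw [part_succ, part_succ, ih, v4 r l (by omega) (by omega)]
  have hSA' : Semistd μ A' := by
    intro l r
    unfold Violates
    rw [not_lt]
    by_cases h1 : l = k
    · subst h1
      rw [pl1 l le_rfl]
      by_cases h2 : r + 1 < i
      · rw [pk0 _ h2]; exact hSS l r
      · rw [pk1 _ (by omega)]
        exact (hN1 _ (by omega)).trans (hU3 r (by omega))
    by_cases h2 : l = k + 1
    · subst h2
      rw [pl2 _ le_rfl]
      by_cases h2 : r < i
      · rw [pk0 _ h2]; exact hSS (k + 1) r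
      · rw [pk1 _ (by omega)]
        exact (hLk2 r).trans (hN2 r (by omega))
    · have hl : ∀ l', l' ≠ k + 1 → ∀ r, part μ A' l' r = part μ A l' r := fun l' h r => by
        rcases lt_or_ge l' (k + 1) with h' | h'
        · exact pl1 l' (by omega) r
        · exact pl2 l' (by omega) r
      rw [hl _ h2, hl _ (by omega)]
      exact hSS l r
  have q1 : ∀ j ≤ i, ∀ l, part κ (transp A') j l = part κ (transp A) j l := fun j hj l =>
    part_congr fun r hr => v1 r l (by omega)
  have hQ' : ∀ i l, part κ (transp A') (i + 1) l = part κ (transp A') i l + A' (i, l) :=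
    fun i l => part_succ κ (transp A') i l
  have hVA' : Violates κ (transp A') i k := by
    unfold Violates
    rw [hQ', q1 _ le_rfl, q1 _ le_rfl, v3 i le_rfl]
    have h1 := hN1 i le_rfl
    rw [Ui] at h1
    have h2 := hP2 i
    omega
  refine ⟨mem_filter.2 ⟨hmem, hSA'⟩, ⟨hVA', ?_, ?_⟩, ?_, ?_⟩
  · intro j hj l
    have := hk j hj l
    unfold Violates at this ⊢
    rw [q1 _ (by omega), q1 _ (by omega)]; exact this
  · intro l hl
    have := hi l hl
    unfold Violates at this ⊢
    rw [hQ', q1 _ le_rfl, q1 _ le_rfl, v4 _ _ (by omega) (by omega), ← hQ]; exact this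
  · have hUU : upperEnd μ κ i k A' = U := by
      funext r
      unfold upperEnd
      rw [q1 _ le_rfl, q1 _ le_rfl, pl2 _ le_rfl, pl2 _ le_rfl, pl1 _ le_rfl]
      rfl
    have hLL : lowerEnd μ k A' = Lo := by
      funext r
      unfold lowerEnd
      rw [pl2 _ le_rfl, pl1 _ le_rfl]
      rfl
    have hNN : ∀ r, i ≤ r → flippedEnd μ κ i k A' r = part μ A (k + 1) r := fun r hr => by
      unfold flippedEnd
      rw [hUU, hLL, pk1 r hr, Nr]
      have h1 := hL r
      have h2 := hU1 r hr
      omega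
    funext ⟨r, l⟩
    unfold latticeFlip
    simp only
    split_ifs with h1 h2 h3
    · exact v1 r l h1
    · subst h2
      rw [hNN r (by omega), pl1 _ le_rfl, hP]; omega
    · subst h3
      rw [hNN r (by omega), pl2 _ le_rfl]
      have := hP2 r
      omega
    · exact v4 r l h2 h3
  · rw [hrow]
    have key : ∀ t, i + 1 ≤ t → part κ (transp A') t k + 1 +
        min (part μ A (k + 2) t) (part μ A k (t - 1)) =
          part κ (transp A) t (k + 1) + part μ A (k + 2) t := by
      intro t ht
      induction t, ht using Nat.le_induction with
      | base =>
        rw [hQ', hQ, q1 _ le_rfl, v2 i le_rfl, Nat.add_sub_cancel]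
        have h1 := hL i
        have h2 := hU1 i le_rfl
        have h3 := hN2 i le_rfl
        have h4 := hLk i
        have h5 := min_add_max (part μ A (k + 2) (i + 1)) (part μ A k i)
        have h6 := Lr i
        have h7 := Nr i
        have h8 := hP2 i
        rw [Ui] at h2 h7
        omega
      | succ t ht ih =>
        rw [hQ', hQ, v2 t (by omega), Nat.add_sub_cancel]
        have h1 := hL t
        have h2 := hU1 t (by omega)
        have h3 := hN2 t (by omega)
        have h4 := hLk t
        have h5 := min_add_max (part μ A (k + 2) (t + 1)) (part μ A k t)
        have h6 := Lr t
        have h7 := Nr t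
        have h8 := hP2 t
        have h9 := Ur t (by omega)
        omega
    have hc0 := key n (by omega)
    rw [part_eq_zero hμ hA (k + 2) le_rfl, Nat.zero_min, part_eq, part_eq, rowSum_transp,
      rowSum_transp] at hc0
    have hc1 : colSum n A' k + colSum n A' (k + 1) = colSum n A k + colSum n A (k + 1) := by
      unfold colSum
      rw [← Finset.sum_add_distrib, ← Finset.sum_add_distrib]
      exact Finset.sum_congr rfl fun r _ => v23 r
    have hc2 : ∀ l, l ≠ k → l ≠ k + 1 → colSum n A' l = colSum n A l := fun l h h' =>
      Finset.sum_congr rfl fun r _ => v4 r l h h'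
    have hv : (shift fun l => κ l + colSum n A' l) =
        (shift fun l => κ l + colSum n A l) ∘ swap k (k + 1) := by
      funext l
      simp only [shift, Function.comp]
      by_cases h1 : l = k
      · subst h1
        rw [swap_apply_left]; push_cast; omega
      · by_cases h2 : l = k + 1
        · subst h2
          rw [swap_apply_right]; push_cast; omega
        · rw [swap_apply_of_ne_of_ne h1 h2, hc2 l h1 h2]
    rw [hv]
    exact hΦ _ _ k hkn

/-! ### Permutations of coordinates -/

theorem sum_range_comp_perm {M : Type*} [AddCommMonoid M] {n : ℕ} {π : Perm ℕ}
    (hπ : ∀ i, n ≤ i → π i = i) (f : ℕ → M) : ∑ i ∈ range n, f (π i) = ∑ i ∈ range n, f i := by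
  refine Equiv.Perm.sum_comp π (range n) f fun i hi => ?_
  by_contra h
  exact hi (hπ i (by simpa using h))

theorem symm_fixes {n : ℕ} {π : Perm ℕ} (hπ : ∀ i, n ≤ i → π i = i) :
    ∀ i, n ≤ i → π.symm i = i := fun i hi => by
  rw [Equiv.symm_apply_eq, hπ i hi]

theorem apply_ge_of_fixes {n : ℕ} {π : Perm ℕ} (hπ : ∀ i, n ≤ i → π i = i) {i : ℕ} :
    n ≤ π i ↔ n ≤ i := by
  constructor
  · intro h
    have := hπ _ h
    rw [π.injective this] at h
    exact h
  · intro h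
    rw [hπ i h]; exact h

theorem fixes_one (n : ℕ) : ∀ i, n ≤ i → (1 : Perm ℕ) i = i := fun _ _ => rfl

theorem swap_fixes {n k : ℕ} (hk : k + 1 < n) : ∀ i, n ≤ i → swap k (k + 1) i = i :=
  fun i hi => swap_apply_of_ne_of_ne (by omega) (by omega)

/-- Permute the rows and columns of a matrix. -/
def permute (π τ : Perm ℕ) (A : ℕ × ℕ → ℕ) : ℕ × ℕ → ℕ := fun p => A (π p.1, τ p.2)

theorem rowSum_permute {n : ℕ} (π : Perm ℕ) {τ : Perm ℕ} (hτ : ∀ i, n ≤ i → τ i = i)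
    (A : ℕ × ℕ → ℕ) : rowSum n (permute π τ A) = rowSum n A ∘ π := by
  funext i
  exact sum_range_comp_perm hτ fun l => A (π i, l)

theorem colSum_permute {n : ℕ} {π : Perm ℕ} (τ : Perm ℕ) (hπ : ∀ i, n ≤ i → π i = i)
    (A : ℕ × ℕ → ℕ) : colSum n (permute π τ A) = colSum n A ∘ τ := by
  funext i
  exact sum_range_comp_perm hπ fun l => A (l, τ i)

theorem permute_mem_mats {n m : ℕ} {π τ : Perm ℕ} (hπ : ∀ i, n ≤ i → π i = i)
    (hτ : ∀ i, n ≤ i → τ i = i) {A : ℕ × ℕ → ℕ} (hA : A ∈ mats n m) :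
    permute π τ A ∈ mats n m := by
  rw [mem_mats] at hA ⊢
  constructor
  · rw [rowSum_permute π hτ, ← hA.1]
    exact sum_range_comp_perm hπ (rowSum n A)
  · intro i l h
    exact hA.2 _ _ (by rwa [apply_ge_of_fixes hπ, apply_ge_of_fixes hτ])

theorem permute_permute_symm (π τ : Perm ℕ) (A : ℕ × ℕ → ℕ) :
    permute π τ (permute π.symm τ.symm A) = A := by
  funext p; simp [permute]

theorem permute_symm_permute (π τ : Perm ℕ) (A : ℕ × ℕ → ℕ) :
    permute π.symm τ.symm (permute π τ A) = A := by
  funext p; simp [permute]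

theorem sum_mats_permute {M : Type*} [AddCommMonoid M] (n m : ℕ) {π τ : Perm ℕ}
    (hπ : ∀ i, n ≤ i → π i = i) (hτ : ∀ i, n ≤ i → τ i = i) (f : (ℕ → ℕ) → (ℕ → ℕ) → M) :
    ∑ A ∈ mats n m, f (rowSum n A ∘ π) (colSum n A ∘ τ) =
      ∑ A ∈ mats n m, f (rowSum n A) (colSum n A) := by
  refine Finset.sum_nbij' (permute π τ) (permute π.symm τ.symm)
    (fun A hA => permute_mem_mats hπ hτ hA)
    (fun A hA => permute_mem_mats (symm_fixes hπ) (symm_fixes hτ) hA)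
    (fun A _ => permute_symm_permute π τ A) (fun A _ => permute_permute_symm π τ A) ?_
  intro A _
  rw [rowSum_permute π hτ, colSum_permute τ hπ]

/-- Extend a permutation of `Fin n` by the identity. -/
def extPerm {n : ℕ} (σ : Perm (Fin n)) : Perm ℕ := σ.extendDomain Fin.equivSubtype

theorem extPerm_coe {n : ℕ} (σ : Perm (Fin n)) (i : Fin n) : extPerm σ i = σ i :=
  Equiv.Perm.extendDomain_apply_image σ Fin.equivSubtype i

theorem extPerm_fixes {n : ℕ} (σ : Perm (Fin n)) : ∀ i, n ≤ i → extPerm σ i = i := fun i hi =>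
  Equiv.Perm.extendDomain_apply_not_subtype σ Fin.equivSubtype (by omega)

/-! ### Coefficients of alternants -/

/-- The coefficient of `x ^ w` in the alternant `∑ σ, sign σ • x ^ (v ∘ σ)`. -/
def altSign (n : ℕ) (w v : ℕ → ℤ) : ℤ :=
  ∑ σ : Perm (Fin n), (Perm.sign σ : ℤ) * if ∀ i : Fin n, v (σ i : ℕ) = w i then 1 else 0

theorem altSign_alternating (n : ℕ) (w : ℕ → ℤ) : Alternating n (altSign n w) := by
  intro v k hk
  have hs : ∀ x : Fin n, swap k (k + 1) (x : ℕ) =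
      (swap (⟨k, by omega⟩ : Fin n) ⟨k + 1, hk⟩ x : Fin n) := fun x => by
    by_cases h1 : x = ⟨k, by omega⟩
    · subst h1; simp
    · by_cases h2 : x = ⟨k + 1, hk⟩
      · subst h2; simp
      · rw [swap_apply_of_ne_of_ne h1 h2, swap_apply_of_ne_of_ne]
        · intro h; exact h1 (Fin.ext h)
        · intro h; exact h2 (Fin.ext h)
  unfold altSign
  rw [← Finset.sum_neg_distrib]
  refine Fintype.sum_equiv
    (Equiv.mulLeft (swap (⟨k, by omega⟩ : Fin n) ⟨k + 1, hk⟩)) _ _ fun σ => ?_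
  rw [Equiv.coe_mulLeft, Perm.sign_mul, Perm.sign_swap (by simp)]
  simp only [Function.comp, hs, Perm.mul_apply]
  split_ifs with h <;> simp [h]

theorem perm_eq_one_of_strictMono {n : ℕ} {σ : Perm (Fin n)} (h : StrictMono σ) : σ = 1 :=
  Equiv.ext fun _ => h.apply_eq

theorem altSign_shift_of_antitone {n : ℕ} {a b : ℕ → ℕ} (ha : Antitone a) (hb : Antitone b) :
    altSign n (shift a) (shift b) = if ∀ i : Fin n, b i = a i then 1 else 0 := by
  unfold altSign
  rw [Finset.sum_eq_single 1]
  · simp [shift]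
  · intro σ _ hσ
    rw [if_neg, mul_zero]
    intro h
    refine hσ (perm_eq_one_of_strictMono fun i j hij => ?_)
    by_contra hle
    have h1 := h i
    have h2 := h j
    simp only [shift] at h1 h2
    have h3 : (σ j : ℕ) ≤ σ i := by simpa using hle
    have h4 := hb h3
    have h5 : (i : ℕ) < j := hij
    have h6 := ha h5.le
    omega
  · simp

theorem sum_mul_le_sum_mul_perm {n : ℕ} {c : ℕ → ℕ} (hc : ∀ i j, i ≤ j → j < n → c j ≤ c i)
    (σ : Perm (Fin n)) :
    ∑ i : Fin n, (c i : ℤ) * (i : ℕ) ≤ ∑ i : Fin n, (c i : ℤ) * (σ i : ℕ) := by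
  refine Antivary.sum_mul_le_sum_mul_comp_perm (f := fun i : Fin n => (c i : ℤ))
    (g := fun i : Fin n => ((i : ℕ) : ℤ)) ?_
  intro i j hij
  have : (i : ℕ) < j := by simpa using hij
  simpa using hc i j this.le j.2

/-- A symmetric family orthogonal to all shifted alternants vanishes. -/
theorem eq_zero_of_sum_altSign_eq_zero {n : ℕ} (D : (ℕ → ℕ) → ℤ) (S : Finset (ℕ → ℕ))
    (hsymm : ∀ c, ∀ π : Perm ℕ, (∀ i, n ≤ i → π i = i) → D (c ∘ π) = D c)
    (hS : ∀ c, D c ≠ 0 → c ∈ S) (hS0 : ∀ c ∈ S, ∀ i, n ≤ i → c i = 0)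
    (h0 : ∀ w, ∑ c ∈ S, D c * altSign n w (shift c) = 0) (c : ℕ → ℕ) : D c = 0 := by
  by_contra hne
  obtain ⟨c₁, hc₁, hmax⟩ := (S.filter (D · ≠ 0)).exists_max_image
    (fun c => ∑ i : Fin n, (c i : ℤ) ^ 2) ⟨c, mem_filter.2 ⟨hS c hne, hne⟩⟩
  let s : Perm (Fin n) := Tuple.sort fun i : Fin n => OrderDual.toDual (c₁ i)
  have hs := Tuple.monotone_sort fun i : Fin n => OrderDual.toDual (c₁ i)
  set c₂ := c₁ ∘ extPerm s with hc₂
  have hD2 : D c₂ ≠ 0 := by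
    rw [hc₂, hsymm _ _ (extPerm_fixes s)]
    exact (mem_filter.1 hc₁).2
  have hanti : ∀ i j, i ≤ j → j < n → c₂ j ≤ c₂ i := fun i j hij hj => by
    have := hs (show (⟨i, by omega⟩ : Fin n) ≤ ⟨j, hj⟩ from hij)
    have e1 := extPerm_coe s ⟨i, by omega⟩
    have e2 := extPerm_coe s ⟨j, hj⟩
    simp only [hc₂, Function.comp] at *
    rw [e1, e2]
    exact this
  have hsq : ∑ i : Fin n, (c₂ i : ℤ) ^ 2 = ∑ i : Fin n, (c₁ i : ℤ) ^ 2 := by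
    rw [← Equiv.sum_comp s fun i : Fin n => (c₁ i : ℤ) ^ 2]
    refine Finset.sum_congr rfl fun i _ => ?_
    simp only [hc₂, Function.comp]
    rw [extPerm_coe]
  refine hD2 ?_
  have h := h0 (shift c₂)
  simp only [altSign, Finset.mul_sum] at h
  rw [Finset.sum_comm, Finset.sum_eq_single 1, Finset.sum_eq_single c₂] at h
  · simpa using h
  · intro c' hc' hcc
    rw [if_neg, mul_zero, mul_zero]
    intro hall
    refine hcc (funext fun i => ?_)
    rcases lt_or_ge i n with hi | hi
    · have := hall ⟨i, hi⟩
      simpa [shift] using this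
    · rw [hS0 c' hc' i hi, hS0 c₂ (hS _ hD2) i hi]
  · intro hc
    exact absurd (hS _ hD2) hc
  · intro σ _ hσ
    refine Finset.sum_eq_zero fun c' hc' => ?_
    by_cases hD' : D c' = 0
    · rw [hD', zero_mul]
    rw [if_neg, mul_zero, mul_zero]
    intro hall
    have hle := hmax c' (mem_filter.2 ⟨hc', hD'⟩)
    rw [← hsq, ← Equiv.sum_comp σ fun i : Fin n => (c' i : ℤ) ^ 2] at hle
    have hre := sum_mul_le_sum_mul_perm hanti σ
    have hexp : ∑ i : Fin n, (c' (σ i : ℕ) : ℤ) ^ 2 =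
        ∑ i : Fin n, (c₂ i : ℤ) ^ 2 + 2 * (∑ i : Fin n, (c₂ i : ℤ) * (σ i : ℕ) -
          ∑ i : Fin n, (c₂ i : ℤ) * (i : ℕ)) + ∑ i : Fin n, (((σ i : ℕ) : ℤ) - (i : ℕ)) ^ 2 := by
      rw [← Finset.sum_sub_distrib, Finset.mul_sum, ← Finset.sum_add_distrib,
        ← Finset.sum_add_distrib]
      refine Finset.sum_congr rfl fun i _ => ?_
      have := hall i
      simp only [shift] at this
      rw [show (c' (σ i : ℕ) : ℤ) = c₂ i + (((σ i : ℕ) : ℤ) - (i : ℕ)) by linarith]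
      ring
    have hnn : ∑ i : Fin n, (((σ i : ℕ) : ℤ) - (i : ℕ)) ^ 2 ≤ 0 := by linarith
    have hz := (Finset.sum_eq_zero_iff_of_nonneg fun i _ => sq_nonneg _).1
      (le_antisymm hnn (Finset.sum_nonneg fun i _ => sq_nonneg _))
    refine hσ (Equiv.ext fun i => Fin.ext ?_)
    have := pow_eq_zero_iff (two_ne_zero) |>.1 (hz i (mem_univ i))
    simp only [Perm.one_apply]
    omega
  · simp

/-! ### Littlewood–Richardson matrices -/

theorem Semistd.part_antitone {μ : ℕ → ℕ} (hμ : Antitone μ) {A : ℕ × ℕ → ℕ} (h : Semistd μ A)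
    (k : ℕ) : Antitone (part μ A k) :=
  antitone_nat_of_succ_le (part_succ_le_part hμ fun k' _ => h k')

theorem Semistd.isPart {n m : ℕ} {μ : ℕ → ℕ} (hμ : IsPart n μ) {A : ℕ × ℕ → ℕ} (hA : A ∈ mats n m)
    (h : Semistd μ A) : IsPart n fun i => μ i + rowSum n A i :=
  ⟨h.part_antitone hμ.1 n, fun i hi => by simp [hμ.2 i hi, rowSum_eq_zero hA hi]⟩

theorem isPart_zero (n : ℕ) : IsPart n 0 := ⟨fun _ _ _ => le_rfl, fun _ _ => rfl⟩

theorem Semistd.part_zero_eq_zero {A : ℕ × ℕ → ℕ} (h : Semistd 0 A) {k i : ℕ} (hki : k ≤ i) :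
    part 0 A k i = 0 := by
  induction k generalizing i with
  | zero => simp
  | succ k ih =>
    obtain ⟨i, rfl⟩ : ∃ j, i = j + 1 := ⟨i - 1, by omega⟩
    have h1 := h k i
    unfold Violates at h1
    rw [ih (by omega)] at h1
    omega

theorem Semistd.apply_eq_zero {A : ℕ × ℕ → ℕ} (h : Semistd 0 A) {k i : ℕ} (hki : k < i) :
    A (i, k) = 0 := by
  have := h.part_zero_eq_zero (Nat.succ_le_of_lt hki)
  rw [Nat.succ_eq_add_one, part_succ] at this
  omega

/-- The diagonal matrix with given diagonal. -/
def diagMat (ρ : ℕ → ℕ) : ℕ × ℕ → ℕ := fun p => if p.1 = p.2 then ρ p.1 else 0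

theorem transp_diagMat (ρ : ℕ → ℕ) : transp (diagMat ρ) = diagMat ρ := by
  funext p
  simp only [transp, diagMat]
  by_cases h : p.1 = p.2
  · simp [h]
  · rw [if_neg h, if_neg (Ne.symm h)]

theorem part_diagMat (ρ : ℕ → ℕ) (k i : ℕ) : part 0 (diagMat ρ) k i = if i < k then ρ i else 0 := by
  simp [part, diagMat]

theorem semistd_diagMat {ρ : ℕ → ℕ} (hρ : Antitone ρ) : Semistd 0 (diagMat ρ) := by
  intro k i h
  unfold Violates at h
  rw [part_diagMat, part_diagMat] at h
  have := hρ (Nat.le_succ i)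
  split_ifs at h <;> simp_all <;> omega

theorem rowSum_diagMat {n : ℕ} {ρ : ℕ → ℕ} (hρ : IsPart n ρ) : rowSum n (diagMat ρ) = ρ := by
  funext i
  have := part_diagMat ρ n i
  rw [part_eq, Pi.zero_apply, zero_add] at this
  rw [this]
  split_ifs with h
  · rfl
  · exact (hρ.2 i (by omega)).symm

theorem diagMat_mem_mats {n m : ℕ} {ρ : ℕ → ℕ} (hρ : IsPart n ρ) (hm : ∑ i ∈ range n, ρ i = m) :
    diagMat ρ ∈ mats n m := by
  rw [mem_mats, rowSum_diagMat hρ]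
  refine ⟨hm, fun i l h => ?_⟩
  simp only [diagMat]
  split_ifs with hil
  · exact hρ.2 i (by omega)
  · rfl

theorem eq_diagMat_of_semistd {n m : ℕ} {A : ℕ × ℕ → ℕ} (hA : A ∈ mats n m) (h : Semistd 0 A)
    (h' : Semistd 0 (transp A)) : A = diagMat (rowSum n A) := by
  funext ⟨i, l⟩
  have hoff : ∀ i l, i ≠ l → A (i, l) = 0 := fun i l hil => by
    rcases lt_or_gt_of_ne hil with h1 | h1
    · exact h'.apply_eq_zero h1
    · exact h.apply_eq_zero h1
  simp only [diagMat]
  split_ifs with hil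
  · subst hil
    rcases lt_or_ge i n with hi | hi
    · exact (Finset.sum_eq_single i (fun l _ hl => hoff i l hl.symm)
        fun hn => absurd (mem_range.2 hi) hn).symm
    · rw [rowSum_eq_zero hA hi]
      exact (mem_mats.1 hA).2 _ _ (Or.inl hi)
  · exact hoff i l hil

theorem sum_semistd_lattice_zero {M : Type*} [AddCommMonoid M] {n m : ℕ} {ρ : ℕ → ℕ}
    (hρ : IsPart n ρ) (hm : ∑ i ∈ range n, ρ i = m) (g : (ℕ → ℕ) → M) :
    ∑ B ∈ mats n m with Semistd 0 B ∧ Semistd 0 (transp B),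
      (if rowSum n B = ρ then g (colSum n B) else 0) = g ρ := by
  have hd : Semistd 0 (diagMat ρ) := semistd_diagMat hρ.1
  have hcol : colSum n (diagMat ρ) = ρ := by
    rw [← rowSum_transp, transp_diagMat, rowSum_diagMat hρ]
  rw [Finset.sum_eq_single (diagMat ρ)]
  · rw [if_pos (rowSum_diagMat hρ), hcol]
  · intro B hB hne
    rw [mem_filter] at hB
    rw [if_neg]
    intro h
    exact hne (h ▸ eq_diagMat_of_semistd hB.1 hB.2.1 hB.2.2)
  · intro h
    exact absurd (mem_filter.2 ⟨diagMat_mem_mats hρ hm, hd, by rwa [transp_diagMat]⟩) h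

/-- The number of semistandard fillings of `(μ + u) / μ` of content `c`. -/
noncomputable def skewKostka (n m : ℕ) (μ u c : ℕ → ℕ) : ℤ :=
  ∑ A ∈ mats n m with Semistd μ A, if rowSum n A = u ∧ colSum n A = c then 1 else 0

theorem skewKostka_eq_sum {n m : ℕ} {μ u : ℕ → ℕ} (hμ : IsPart n μ)
    (hu : IsPart n fun i => μ i + u i) (c : ℕ → ℕ) :
    skewKostka n m μ u c = ∑ A ∈ mats n m, altSign n (shift fun i => μ i + u i)
      (shift fun i => μ i + rowSum n A i) * if colSum n A = c then 1 else 0 := by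
  rw [sum_mats_eq_sum_semistd n m hμ
    (fun v c' => altSign n (shift fun i => μ i + u i) v * if c' = c then 1 else 0)]
  · refine Finset.sum_congr rfl fun A hA => ?_
    rw [mem_filter] at hA
    rw [altSign_shift_of_antitone hu.1 (hA.2.isPart hμ hA.1).1]
    have : (∀ i : Fin n, μ i + rowSum n A i = μ i + u i) ↔ rowSum n A = u := by
      constructor
      · intro h
        funext i
        rcases lt_or_ge i n with hi | hi
        · simpa using h ⟨i, hi⟩
        · have : μ i + u i = 0 := hu.2 i hi
          rw [rowSum_eq_zero hA.1 hi]
          omega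
      · rintro rfl i; rfl
    simp only [this]
    split_ifs <;> simp_all
  · intro c' v k hk
    simp only [altSign_alternating n _ v k hk, neg_mul]

theorem skewKostka_comp_perm {n m : ℕ} {μ u : ℕ → ℕ} (hμ : IsPart n μ) (c : ℕ → ℕ) (π : Perm ℕ)
    (hπ : ∀ i, n ≤ i → π i = i) : skewKostka n m μ u (c ∘ π) = skewKostka n m μ u c := by
  by_cases hu : IsPart n fun i => μ i + u i
  · rw [skewKostka_eq_sum hμ hu, skewKostka_eq_sum hμ hu,
      ← sum_mats_permute n m (fixes_one n) hπ fun r c' => altSign n (shift fun i => μ i + u i)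
      (shift fun i => μ i + r i) * if c' = c ∘ π then 1 else 0]
    refine Finset.sum_congr rfl fun A _ => ?_
    have : colSum n A ∘ π = c ∘ π ↔ colSum n A = c := π.surjective.injective_comp_right.eq_iff
    simp only [this]
    rfl
  · have : ∀ c, skewKostka n m μ u c = 0 := fun c => Finset.sum_eq_zero fun A hA => by
      rw [mem_filter] at hA
      rw [if_neg]
      rintro ⟨rfl, -⟩
      exact hu (hA.2.isPart hμ hA.1)
    rw [this, this]

theorem rowSum_mem_piAntidiag {n m : ℕ} {A : ℕ × ℕ → ℕ} (hA : A ∈ mats n m) :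
    rowSum n A ∈ piAntidiag (range n) m := by
  rw [mem_piAntidiag]
  refine ⟨(mem_mats.1 hA).1, fun i hi => ?_⟩
  by_contra h
  exact hi (rowSum_eq_zero hA (by simpa using h))

theorem colSum_mem_piAntidiag {n m : ℕ} {A : ℕ × ℕ → ℕ} (hA : A ∈ mats n m) :
    colSum n A ∈ piAntidiag (range n) m :=
  rowSum_mem_piAntidiag (transp_mem_mats hA)

theorem sum_skewKostka_mul (n m : ℕ) (μ u : ℕ → ℕ) (g : (ℕ → ℕ) → ℤ) :
    ∑ c ∈ piAntidiag (range n) m, skewKostka n m μ u c * g c =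
      ∑ A ∈ mats n m with Semistd μ A, if rowSum n A = u then g (colSum n A) else 0 := by
  simp only [skewKostka, Finset.sum_mul]
  rw [Finset.sum_comm]
  refine Finset.sum_congr rfl fun A hA => ?_
  rw [Finset.sum_eq_single (colSum n A)]
  · simp
  · intro c _ hc
    rw [if_neg fun h => hc h.2.symm, zero_mul]
  · intro h
    exact absurd (colSum_mem_piAntidiag (mem_filter.1 hA).1) h

/-- The semistandard filling `A` corresponds, with the same content, to a semistandard filling of
the straight shape given by the content of a Littlewood–Richardson filling. -/
theorem skewKostka_eq_sum_lattice {n m : ℕ} {μ : ℕ → ℕ} (hμ : IsPart n μ) (u c : ℕ → ℕ) :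
    skewKostka n m μ u c = ∑ A ∈ mats n m with Semistd μ A ∧ Semistd 0 (transp A),
      if rowSum n A = u then skewKostka n m 0 (colSum n A) c else 0 := by
  rw [← sub_eq_zero]
  refine eq_zero_of_sum_altSign_eq_zero (n := n) (fun c => skewKostka n m μ u c -
      ∑ A ∈ mats n m with Semistd μ A ∧ Semistd 0 (transp A),
      if rowSum n A = u then skewKostka n m 0 (colSum n A) c else 0)
    (piAntidiag (range n) m) ?_ ?_ ?_ ?_ c
  · intro c π hπ
    simp only [skewKostka_comp_perm hμ c π hπ, skewKostka_comp_perm (isPart_zero n) c π hπ]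
  · intro c hc
    by_contra hcS
    have h0 : ∀ μ u, skewKostka n m μ u c = 0 := fun μ u => Finset.sum_eq_zero fun A hA => by
      rw [if_neg]
      rintro ⟨-, rfl⟩
      exact hcS (colSum_mem_piAntidiag (mem_filter.1 hA).1)
    exact hc (by simp [h0])
  · intro c hc i hi
    by_contra h
    have := (mem_piAntidiag.1 hc).2 i h
    simp at this
    omega
  · intro w
    simp only [sub_mul, Finset.sum_sub_distrib, Finset.sum_mul, ite_mul, zero_mul]
    have key : ∀ {μ : ℕ → ℕ} (_ : IsPart n μ) (u : ℕ → ℕ),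
        ∑ A ∈ mats n m with Semistd μ A,
          (if rowSum n A = u then altSign n w (shift (colSum n A)) else 0) =
        ∑ A ∈ mats n m with Semistd μ A ∧ Semistd 0 (transp A),
          if rowSum n A = u then altSign n w (shift (colSum n A)) else 0 := fun {μ} hμ u => by
      have h := sum_semistd_eq_sum_lattice n m hμ (isPart_zero n)
        (fun r v => if r = u then altSign n w v else 0) fun c v k hk => by
          simp only [altSign_alternating n w v k hk]
          split_ifs <;> simp
      simpa using h
    rw [sum_skewKostka_mul n m μ u fun c => altSign n w (shift c), key hμ, Finset.sum_comm,
      sub_eq_zero]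
    refine Finset.sum_congr rfl fun A hA => ?_
    rw [mem_filter] at hA
    split_ifs with hu
    · rw [sum_skewKostka_mul n m 0 _ fun c => altSign n w (shift c), key (isPart_zero n),
        sum_semistd_lattice_zero (g := fun c => altSign n w (shift c))]
      · have := hA.2.2.isPart (isPart_zero n) (transp_mem_mats hA.1)
        simpa [rowSum_transp] using this
      · rw [← sum_rowSum]; exact (mem_mats.1 hA.1).1
    · simp

theorem sum_semistd_eq_sum_sum_lattice {n m : ℕ} {μ : ℕ → ℕ} (hμ : IsPart n μ)
    (G : (ℕ → ℕ) → (ℕ → ℕ) → ℤ) :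
    ∑ A ∈ mats n m with Semistd μ A, G (rowSum n A) (colSum n A) =
      ∑ A ∈ mats n m with Semistd μ A ∧ Semistd 0 (transp A), ∑ B ∈ mats n m with Semistd 0 B,
        if rowSum n B = colSum n A then G (rowSum n A) (colSum n B) else 0 := by
  have h1 : ∑ A ∈ mats n m with Semistd μ A, G (rowSum n A) (colSum n A) =
      ∑ u ∈ piAntidiag (range n) m, ∑ c ∈ piAntidiag (range n) m, skewKostka n m μ u c * G u c := by
    simp only [sum_skewKostka_mul]
    rw [Finset.sum_comm]
    refine Finset.sum_congr rfl fun A hA => ?_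
    rw [Finset.sum_ite_eq, if_pos (rowSum_mem_piAntidiag (mem_filter.1 hA).1)]
  rw [h1]
  simp only [skewKostka_eq_sum_lattice hμ, Finset.sum_mul, ite_mul, zero_mul]
  have h2 : ∀ u ∈ piAntidiag (range n) m, (∑ c ∈ piAntidiag (range n) m,
      ∑ A ∈ mats n m with Semistd μ A ∧ Semistd 0 (transp A),
        if rowSum n A = u then skewKostka n m 0 (colSum n A) c * G u c else 0) =
      ∑ A ∈ mats n m with Semistd μ A ∧ Semistd 0 (transp A), if rowSum n A = u then
        ∑ B ∈ mats n m with Semistd 0 B,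
          (if rowSum n B = colSum n A then G u (colSum n B) else 0) else 0 := fun u _ => by
    rw [Finset.sum_comm]
    refine Finset.sum_congr rfl fun A _ => ?_
    split_ifs
    · exact sum_skewKostka_mul n m 0 _ (G u)
    · simp
  rw [Finset.sum_congr rfl h2, Finset.sum_comm]
  refine Finset.sum_congr rfl fun A hA => ?_
  rw [Finset.sum_ite_eq, if_pos (rowSum_mem_piAntidiag (mem_filter.1 hA).1)]

/-- A filling with strictly increasing columns and lattice reading word. -/
def IsLRMat (μ : ℕ → ℕ) (A : ℕ × ℕ → ℕ) : Prop := Semistd μ A ∧ Semistd 0 (transp A)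

/-- Skew Cauchy identity, with both sides expanded by the Littlewood–Richardson rule. -/
theorem sum_mats_eq_sum_lr_pairs {n m : ℕ} {μ κ : ℕ → ℕ} (hμ : IsPart n μ) (hκ : IsPart n κ)
    (Φ : (ℕ → ℤ) → (ℕ → ℤ) → ℤ) (h₁ : ∀ w, Alternating n fun v => Φ v w)
    (h₂ : ∀ v, Alternating n (Φ v)) :
    ∑ A ∈ mats n m, Φ (shift fun i => μ i + rowSum n A i) (shift fun i => κ i + colSum n A i) =
      ∑ A ∈ mats n m with IsLRMat μ A, ∑ B ∈ mats n m with IsLRMat κ B,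
        if colSum n B = colSum n A then
          Φ (shift fun i => μ i + rowSum n A i) (shift fun i => κ i + rowSum n B i) else 0 := by
  rw [sum_mats_eq_sum_semistd n m hμ (fun v c => Φ v (shift fun i => κ i + c i)) fun c => h₁ _,
    sum_semistd_eq_sum_sum_lattice hμ
      fun u c => Φ (shift fun i => μ i + u i) (shift fun i => κ i + c i)]
  refine Finset.sum_congr (by ext; rw [mem_filter, mem_filter]; rfl) fun A _ => ?_
  rw [sum_semistd_eq_sum_lattice n m (isPart_zero n) hκ
    (fun r v => if r = colSum n A then Φ (shift fun i => μ i + rowSum n A i) v else 0)]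
  · refine Finset.sum_nbij' transp transp ?_ ?_ (fun _ _ => rfl) (fun _ _ => rfl) fun _ _ => rfl
    · intro B hB
      rw [mem_filter] at hB ⊢
      exact ⟨transp_mem_mats hB.1, hB.2.2, hB.2.1⟩
    · intro B hB
      rw [mem_filter] at hB ⊢
      exact ⟨transp_mem_mats hB.1, hB.2.2, hB.2.1⟩
  · intro c v k hk
    simp only [h₂ _ v k hk]
    split_ifs <;> simp

/-! ### Tuples of matrices -/

def tuples (n : ℕ) {r : ℕ} (ν : Fin r → ℕ) : Finset (Fin r → ℕ × ℕ → ℕ) :=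
  Fintype.piFinset fun k => mats n (ν k)

theorem mem_tuples {n r : ℕ} {ν : Fin r → ℕ} {A : Fin r → ℕ × ℕ → ℕ} :
    A ∈ tuples n ν ↔ ∀ k, A k ∈ mats n (ν k) := Fintype.mem_piFinset

def rowTot (n : ℕ) {r : ℕ} (A : Fin r → ℕ × ℕ → ℕ) (i : ℕ) : ℕ := ∑ k, rowSum n (A k) i

def colTot (n : ℕ) {r : ℕ} (A : Fin r → ℕ × ℕ → ℕ) (i : ℕ) : ℕ := ∑ k, colSum n (A k) i

/-- The shape obtained from `μ` after the first `k` layers of `A`. -/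
def layer (n : ℕ) {r : ℕ} (μ : ℕ → ℕ) (A : Fin r → ℕ × ℕ → ℕ) (k i : ℕ) : ℕ :=
  μ i + ∑ k' : Fin r, if (k' : ℕ) < k then rowSum n (A k') i else 0

def IsLRTuple (n : ℕ) {r : ℕ} (μ : ℕ → ℕ) (A : Fin r → ℕ × ℕ → ℕ) : Prop :=
  ∀ k : Fin r, IsLRMat (layer n μ A k) (A k)

@[simp] theorem layer_zero (n : ℕ) {r : ℕ} (μ : ℕ → ℕ) (A : Fin r → ℕ × ℕ → ℕ) :
    layer n μ A 0 = μ := by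
  funext i; simp [layer]

theorem layer_succ (n : ℕ) {r : ℕ} (μ : ℕ → ℕ) (A : Fin r → ℕ × ℕ → ℕ) (k : Fin r) (i : ℕ) :
    layer n μ A (k + 1) i = layer n μ A k i + rowSum n (A k) i := by
  have : ∀ k' : Fin r, (if (k' : ℕ) < k + 1 then rowSum n (A k') i else 0) =
      (if (k' : ℕ) < k then rowSum n (A k') i else 0) + if k' = k then rowSum n (A k') i else 0 := by
    intro k'
    rcases lt_trichotomy k' k with h | h | h
    · have h1 : (k' : ℕ) < k := h
      rw [if_pos (by omega), if_pos h1, if_neg h.ne, add_zero]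
    · subst h; simp
    · have h1 : (k : ℕ) < k' := h
      rw [if_neg (by omega), if_neg (by omega), if_neg h.ne']
  simp only [layer, this, Finset.sum_add_distrib, Finset.sum_ite_eq', mem_univ, if_true]
  ring

theorem layer_last (n : ℕ) {r : ℕ} (μ : ℕ → ℕ) (A : Fin r → ℕ × ℕ → ℕ) (i : ℕ) :
    layer n μ A r i = μ i + rowTot n A i := by
  simp [layer, rowTot]

theorem IsLRTuple.isPart_layer {n r : ℕ} {ν : Fin r → ℕ} {μ : ℕ → ℕ} {A : Fin r → ℕ × ℕ → ℕ}
    (h : IsLRTuple n μ A) (hμ : IsPart n μ) (hA : A ∈ tuples n ν) (k : ℕ) (hk : k ≤ r) :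
    IsPart n (layer n μ A k) := by
  induction k with
  | zero => simpa using hμ
  | succ k ih =>
    have := (h ⟨k, hk⟩).1.isPart (ih (by omega)) (mem_tuples.1 hA ⟨k, hk⟩)
    rwa [← funext (layer_succ n μ A ⟨k, hk⟩)] at this

theorem IsLRTuple.isPart {n r : ℕ} {ν : Fin r → ℕ} {μ : ℕ → ℕ} {A : Fin r → ℕ × ℕ → ℕ}
    (h : IsLRTuple n μ A) (hμ : IsPart n μ) (hA : A ∈ tuples n ν) :
    IsPart n fun i => μ i + rowTot n A i := by
  have := h.isPart_layer hμ hA r le_rfl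
  rwa [funext (layer_last n μ A)] at this

theorem rowTot_cons (n : ℕ) {r : ℕ} (A₀ : ℕ × ℕ → ℕ) (A : Fin r → ℕ × ℕ → ℕ) (i : ℕ) :
    rowTot n (Fin.cons A₀ A : Fin (r + 1) → ℕ × ℕ → ℕ) i = rowSum n A₀ i + rowTot n A i := by
  simp [rowTot, Fin.sum_univ_succ]

theorem colTot_cons (n : ℕ) {r : ℕ} (A₀ : ℕ × ℕ → ℕ) (A : Fin r → ℕ × ℕ → ℕ) (i : ℕ) :
    colTot n (Fin.cons A₀ A : Fin (r + 1) → ℕ × ℕ → ℕ) i = colSum n A₀ i + colTot n A i := by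
  simp [colTot, Fin.sum_univ_succ]

theorem isLRTuple_cons (n : ℕ) {r : ℕ} (μ : ℕ → ℕ) (A₀ : ℕ × ℕ → ℕ) (A : Fin r → ℕ × ℕ → ℕ) :
    IsLRTuple n μ (Fin.cons A₀ A : Fin (r + 1) → ℕ × ℕ → ℕ) ↔
      IsLRMat μ A₀ ∧ IsLRTuple n (fun i => μ i + rowSum n A₀ i) A := by
  unfold IsLRTuple
  rw [Fin.forall_fin_succ]
  refine and_congr (by simp) (forall_congr' fun k => ?_)
  have : layer n μ (Fin.cons A₀ A : Fin (r + 1) → ℕ × ℕ → ℕ) (k.succ : Fin (r + 1)) =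
      layer n (fun i => μ i + rowSum n A₀ i) A k := by
    funext i
    simp [layer, Fin.sum_univ_succ, add_assoc]
  rw [this, Fin.cons_succ]

theorem sum_tuples_cons {M : Type*} [AddCommMonoid M] (n : ℕ) {r : ℕ} (ν : Fin (r + 1) → ℕ)
    (F : (Fin (r + 1) → ℕ × ℕ → ℕ) → M) :
    ∑ A ∈ tuples n ν, F A =
      ∑ A₀ ∈ mats n (ν 0), ∑ A ∈ tuples n (fun k => ν k.succ), F (Fin.cons A₀ A) := by
  rw [← Finset.sum_product']
  refine Finset.sum_nbij' (fun A => (A 0, fun k => A k.succ)) (fun p => Fin.cons p.1 p.2)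
    ?_ ?_ ?_ ?_ ?_
  · intro A hA
    rw [mem_tuples] at hA
    exact mem_product.2 ⟨hA 0, mem_tuples.2 fun k => hA k.succ⟩
  · intro p hp
    rw [mem_product, mem_tuples] at hp
    rw [mem_tuples, Fin.forall_fin_succ]
    exact ⟨hp.1, hp.2⟩
  · intro A _
    exact Fin.cons_self_tail A
  · intro p _
    simp
  · intro A _
    exact congrArg F (Fin.cons_self_tail A).symm

theorem sum_lrTuples_cons {M : Type*} [AddCommMonoid M] (n : ℕ) {r : ℕ} (ν : Fin (r + 1) → ℕ)
    (μ : ℕ → ℕ) (F : (Fin (r + 1) → ℕ × ℕ → ℕ) → M) :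
    ∑ A ∈ tuples n ν with IsLRTuple n μ A, F A =
      ∑ A₀ ∈ mats n (ν 0) with IsLRMat μ A₀,
        ∑ A ∈ tuples n (fun k => ν k.succ) with IsLRTuple n (fun i => μ i + rowSum n A₀ i) A,
          F (Fin.cons A₀ A) := by
  rw [Finset.sum_filter, sum_tuples_cons, Finset.sum_filter]
  refine Finset.sum_congr rfl fun A₀ _ => ?_
  simp only [isLRTuple_cons]
  by_cases h : IsLRMat μ A₀
  · simp only [h, true_and, if_true]
    rw [Finset.sum_filter]
  · simp [h]

theorem sum_tuples_permute {M : Type*} [AddCommMonoid M] (n : ℕ) {r : ℕ} (ν : Fin r → ℕ)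
    {π τ : Perm ℕ} (hπ : ∀ i, n ≤ i → π i = i) (hτ : ∀ i, n ≤ i → τ i = i)
    (f : (ℕ → ℕ) → (ℕ → ℕ) → M) :
    ∑ A ∈ tuples n ν, f (rowTot n A ∘ π) (colTot n A ∘ τ) =
      ∑ A ∈ tuples n ν, f (rowTot n A) (colTot n A) := by
  refine Finset.sum_nbij' (fun A k => permute π τ (A k)) (fun A k => permute π.symm τ.symm (A k))
    (fun A hA => mem_tuples.2 fun k => permute_mem_mats hπ hτ (mem_tuples.1 hA k))
    (fun A hA => mem_tuples.2 fun k =>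
      permute_mem_mats (symm_fixes hπ) (symm_fixes hτ) (mem_tuples.1 hA k))
    (fun A _ => funext fun k => permute_symm_permute π τ (A k))
    (fun A _ => funext fun k => permute_permute_symm π τ (A k)) ?_
  intro A _
  unfold rowTot colTot
  simp only [rowSum_permute π hτ, colSum_permute τ hπ]
  rfl

theorem alternating_sum_tuples_left (n : ℕ) {r : ℕ} (ν : Fin r → ℕ)
    (Φ : (ℕ → ℤ) → (ℕ → ℤ) → ℤ) (h₁ : ∀ w, Alternating n fun v => Φ v w) (w : ℕ → ℤ) :
    Alternating n fun v => ∑ A ∈ tuples n ν,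
      Φ (fun i => v i + rowTot n A i) (fun i => w i + colTot n A i) := by
  intro v k hk
  simp only
  rw [← sum_tuples_permute n ν (swap_fixes hk) (fixes_one n) fun r c =>
      Φ (fun i => (v ∘ swap k (k + 1)) i + r i) (fun i => w i + c i), ← Finset.sum_neg_distrib]
  exact Finset.sum_congr rfl fun A _ => h₁ _ (fun i => v i + rowTot n A i) k hk

theorem alternating_sum_tuples_right (n : ℕ) {r : ℕ} (ν : Fin r → ℕ)
    (Φ : (ℕ → ℤ) → (ℕ → ℤ) → ℤ) (h₂ : ∀ v, Alternating n (Φ v)) (v : ℕ → ℤ) :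
    Alternating n fun w => ∑ A ∈ tuples n ν,
      Φ (fun i => v i + rowTot n A i) (fun i => w i + colTot n A i) := by
  intro w k hk
  simp only
  rw [← sum_tuples_permute n ν (fixes_one n) (swap_fixes hk) fun r c =>
      Φ (fun i => v i + r i) (fun i => (w ∘ swap k (k + 1)) i + c i), ← Finset.sum_neg_distrib]
  exact Finset.sum_congr rfl fun A _ => h₂ _ (fun i => w i + colTot n A i) k hk

theorem sum_tuples_eq_sum_lr_pairs {n : ℕ} (Φ : (ℕ → ℤ) → (ℕ → ℤ) → ℤ)
    (h₁ : ∀ w, Alternating n fun v => Φ v w) (h₂ : ∀ v, Alternating n (Φ v)) {r : ℕ}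
    (ν : Fin r → ℕ) {μ κ : ℕ → ℕ} (hμ : IsPart n μ) (hκ : IsPart n κ) :
    ∑ A ∈ tuples n ν, Φ (shift fun i => μ i + rowTot n A i) (shift fun i => κ i + colTot n A i) =
      ∑ A ∈ tuples n ν with IsLRTuple n μ A, ∑ B ∈ tuples n ν with IsLRTuple n κ B,
        if ∀ k, colSum n (B k) = colSum n (A k) then
          Φ (shift fun i => μ i + rowTot n A i) (shift fun i => κ i + rowTot n B i) else 0 := by
  induction r generalizing μ κ with
  | zero =>
    have hμ' : ∀ A : Fin 0 → ℕ × ℕ → ℕ, IsLRTuple n μ A := fun A k => k.elim0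
    have hκ' : ∀ A : Fin 0 → ℕ × ℕ → ℕ, IsLRTuple n κ A := fun A k => k.elim0
    have ht : tuples n ν = {Fin.elim0} := Finset.eq_singleton_iff_unique_mem.2
      ⟨mem_tuples.2 fun k => k.elim0, fun A _ => Subsingleton.elim _ _⟩
    simp only [hμ', hκ', Finset.filter_true, ht, Finset.sum_singleton, IsEmpty.forall_iff, if_true,
      rowTot, colTot, Finset.univ_eq_empty, Finset.sum_empty]
  | succ r ih =>
    have hshift : ∀ (μ f g : ℕ → ℕ), (shift fun i => μ i + (f i + g i)) =
        fun i => shift (fun i => μ i + f i) i + g i := fun μ f g => by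
      funext i; simp only [shift]; push_cast; ring
    simp only [sum_tuples_cons, sum_lrTuples_cons, rowTot_cons, colTot_cons]
    simp only [hshift]
    rw [sum_mats_eq_sum_lr_pairs hμ hκ
      (fun v w => ∑ A ∈ tuples n (fun k => ν k.succ),
        Φ (fun i => v i + rowTot n A i) (fun i => w i + colTot n A i))
      (alternating_sum_tuples_left n _ Φ h₁) (alternating_sum_tuples_right n _ Φ h₂)]
    refine Finset.sum_congr rfl fun A₀ hA₀ => ?_
    rw [Finset.sum_comm (s := (tuples n fun k => ν k.succ).filter _)]
    refine Finset.sum_congr rfl fun B₀ hB₀ => ?_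
    rw [mem_filter] at hA₀ hB₀
    simp only [Fin.forall_fin_succ, Fin.cons_zero, Fin.cons_succ]
    split_ifs with h
    · simp only [h, true_and, ← hshift, ← add_assoc]
      exact ih _ (hA₀.2.1.isPart hμ hA₀.1) (hB₀.2.1.isPart hκ hB₀.1)
    · simp [h]

theorem sum_tuples_altSign {n r : ℕ} (ν : Fin r → ℕ) {a b : ℕ → ℕ} (ha : IsPart n a)
    (hb : IsPart n b) :
    ∑ A ∈ tuples n ν, altSign n (shift a) (shift (rowTot n A)) *
        altSign n (shift b) (shift (colTot n A)) =
      #{p ∈ tuples n ν ×ˢ tuples n ν | (IsLRTuple n 0 p.1 ∧ rowTot n p.1 = a) ∧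
        (IsLRTuple n 0 p.2 ∧ rowTot n p.2 = b) ∧ ∀ k, colSum n (p.1 k) = colSum n (p.2 k)} := by
  have h := sum_tuples_eq_sum_lr_pairs
    (fun v w => altSign n (shift a) v * altSign n (shift b) w)
    (fun w v k hk => by simp only [altSign_alternating n _ v k hk, neg_mul])
    (fun v w k hk => by simp only [altSign_alternating n _ w k hk, mul_neg]) ν
    (isPart_zero n) (isPart_zero n)
  simp only [Pi.zero_apply, zero_add] at h
  refine Eq.trans h ?_
  have hkey : ∀ {a : ℕ → ℕ}, IsPart n a → ∀ A ∈ tuples n ν, IsLRTuple n 0 A →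
      altSign n (shift a) (shift (rowTot n A)) = if rowTot n A = a then 1 else 0 := by
    intro a ha A hA hLR
    have hp : IsPart n (rowTot n A) := by simpa using hLR.isPart (isPart_zero n) hA
    rw [altSign_shift_of_antitone ha.1 hp.1]
    refine if_congr ⟨fun h => ?_, fun h i => by rw [h]⟩ rfl rfl
    funext i
    rcases lt_or_ge i n with hi | hi
    · exact h ⟨i, hi⟩
    · rw [ha.2 i hi, hp.2 i hi]
  rw [Finset.card_filter, Finset.sum_product, Finset.sum_filter]
  push_cast
  refine Finset.sum_congr rfl fun A hA => ?_
  split_ifs with hA'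
  · rw [Finset.sum_filter]
    refine Finset.sum_congr rfl fun B hB => ?_
    split_ifs <;> simp_all [eq_comm] <;> tauto
  · simp [hA']

/-! ### Fillings and matrices -/

/-- The matrix counting the letters in each row of a filling. -/
def matOf (lo hi : ℕ → ℕ) (T : ℕ → ℕ → ℕ) : ℕ × ℕ → ℕ := fun p =>
  #{j ∈ Ico (lo p.1) (hi p.1) | T p.1 j = p.2}

/-- The filling with weakly increasing rows determined by a matrix. -/
noncomputable def fillOf (lo hi : ℕ → ℕ) (A : ℕ × ℕ → ℕ) (i j : ℕ) : ℕ :=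
  if lo i ≤ j ∧ j < hi i then sInf {k | j < part lo A (k + 1) i} else 0

def RowWeak (lo hi : ℕ → ℕ) (T : ℕ → ℕ → ℕ) : Prop :=
  ∀ i j₁ j₂, lo i ≤ j₁ → j₁ ≤ j₂ → j₂ < hi i → T i j₁ ≤ T i j₂

theorem part_matOf (lo hi : ℕ → ℕ) (T : ℕ → ℕ → ℕ) (k i : ℕ) :
    part lo (matOf lo hi T) k i = lo i + #{j ∈ Ico (lo i) (hi i) | T i j < k} := by
  unfold part matOf
  rw [Finset.card_eq_sum_card_fiberwise (f := fun j => T i j) (t := range k)]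
  · congr 1
    refine Finset.sum_congr rfl fun l hl => ?_
    rw [filter_filter]
    congr 1
    ext j
    simp only [mem_filter, mem_range] at hl ⊢
    constructor
    · rintro ⟨h, rfl⟩; exact ⟨h, hl, rfl⟩
    · rintro ⟨h, -, h'⟩; exact ⟨h, h'⟩
  · intro j hj
    simpa using (mem_filter.1 hj).2

theorem part_matOf_le {lo hi : ℕ → ℕ} (hle : ∀ i, lo i ≤ hi i) (T : ℕ → ℕ → ℕ) (k i : ℕ) :
    part lo (matOf lo hi T) k i ≤ hi i := by
  rw [part_matOf]
  have := Finset.card_filter_le (Ico (lo i) (hi i)) fun j => T i j < k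
  rw [Nat.card_Ico] at this
  have := hle i
  omega

theorem RowWeak.lt_iff {lo hi : ℕ → ℕ} {T : ℕ → ℕ → ℕ} (hT : RowWeak lo hi T) {i j : ℕ}
    (h₁ : lo i ≤ j) (h₂ : j < hi i) (k : ℕ) :
    T i j < k ↔ j < part lo (matOf lo hi T) k i := by
  rw [part_matOf]
  constructor
  · intro h
    have hsub : Ico (lo i) (j + 1) ⊆ {j ∈ Ico (lo i) (hi i) | T i j < k} := fun j' hj' => by
      rw [mem_Ico] at hj'
      exact mem_filter.2 ⟨mem_Ico.2 ⟨hj'.1, by omega⟩,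
        (hT i j' j hj'.1 (by omega) h₂).trans_lt h⟩
    have := Finset.card_le_card hsub
    rw [Nat.card_Ico] at this
    omega
  · intro h
    by_contra hk
    have hsub : {j ∈ Ico (lo i) (hi i) | T i j < k} ⊆ Ico (lo i) j := fun j' hj' => by
      rw [mem_filter, mem_Ico] at hj'
      refine mem_Ico.2 ⟨hj'.1.1, ?_⟩
      by_contra hjj
      have := hT i j j' h₁ (by omega) hj'.1.2
      omega
    have := Finset.card_le_card hsub
    rw [Nat.card_Ico] at this
    omega

theorem RowWeak.columnStrict_iff {lo hi : ℕ → ℕ} {T : ℕ → ℕ → ℕ} (hT : RowWeak lo hi T)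
    (hlo : Antitone lo) (hhi : Antitone hi) (hle : ∀ i, lo i ≤ hi i) :
    (∀ i₁ i₂ j, i₁ < i₂ → lo i₁ ≤ j → j < hi i₁ → lo i₂ ≤ j → j < hi i₂ → T i₁ j < T i₂ j) ↔
      Semistd lo (matOf lo hi T) := by
  constructor
  · intro h k i hV
    unfold Violates at hV
    rw [← Nat.succ_eq_add_one i] at hV
    have h1 : lo i ≤ part lo (matOf lo hi T) k i := Nat.le_add_right _ _
    have h2 := part_matOf_le hle T (k + 1) i.succ
    have h3 := hlo (Nat.le_succ i)
    have h4 := hhi (Nat.le_succ i)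
    have h5 := (hT.lt_iff (h3.trans h1) (hV.trans_le h2) (k + 1)).2 hV
    have h6 := h i i.succ _ (Nat.lt_succ_self i) h1 (hV.trans_le (h2.trans h4))
      (h3.trans h1) (hV.trans_le h2)
    have h7 := (hT.lt_iff h1 (hV.trans_le (h2.trans h4)) k).1 (by omega)
    exact lt_irrefl _ h7
  · intro h i₁ i₂ j h12 h1 h2 h3 h4
    have hadj : ∀ i, lo i ≤ j → j < hi (i + 1) → T i j < T (i + 1) j := fun i ha hb => by
      rw [hT.lt_iff ha (hb.trans_le (hhi (Nat.le_succ i)))]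
      have := (hT.lt_iff ((hlo (Nat.le_succ i)).trans ha) hb (T (i + 1) j + 1)).1 (Nat.lt_succ_self _)
      exact this.trans_le (not_lt.1 (h (T (i + 1) j) i))
    induction i₂, h12 using Nat.le_induction with
    | base => exact hadj i₁ h1 h4
    | succ i₂ h12 ih =>
      have hlt : i₁ < i₂ := h12
      have h5 : lo i₂ ≤ j := (hlo hlt.le).trans h1
      exact (ih h5 (h4.trans_le (hhi (Nat.le_succ i₂)))).trans (hadj i₂ h5 h4)

theorem lrCount_eq (lo hi : ℕ → ℕ) (T : ℕ → ℕ → ℕ) (i j k : ℕ) :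
    lrCount hi lo T i j k = ∑ i' ∈ range i, matOf lo hi T (i', k) +
      #{j' ∈ Ico (lo i) (hi i) | T i j' = k ∧ j ≤ j'} := by
  have h1 : lrCount hi lo T i j k = #((range (i + 1)).sigma fun i' =>
      {j' ∈ Ico (lo i') (hi i') | T i' j' = k ∧ (i' < i ∨ j ≤ j')}) := by
    unfold lrCount
    rw [← Nat.card_eq_finsetCard]
    refine Nat.card_congr ((Equiv.sigmaEquivProd ℕ ℕ).symm.subtypeEquiv fun p => ?_)
    simp only [mem_sigma, mem_range, mem_filter, mem_Ico, Equiv.sigmaEquivProd_symm_apply]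
    constructor
    · rintro ⟨h | h, h2, h3, h4⟩
      · exact ⟨by omega, ⟨h2, h3⟩, h4, Or.inl h⟩
      · exact ⟨by omega, ⟨h2, h3⟩, h4, Or.inr h.2⟩
    · rintro ⟨h1, ⟨h2, h3⟩, h4, h⟩
      exact ⟨by omega, h2, h3, h4⟩
  rw [h1, Finset.card_sigma, Finset.sum_range_succ]
  congr 1
  · refine Finset.sum_congr rfl fun i' hi' => ?_
    unfold matOf
    congr 1
    ext j'
    simp [mem_range.1 hi']
  · simp

theorem RowWeak.lattice_iff {lo hi : ℕ → ℕ} {T : ℕ → ℕ → ℕ} (hT : RowWeak lo hi T) :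
    (∀ i j k, lrCount hi lo T i j (k + 1) ≤ lrCount hi lo T i j k) ↔
      Semistd 0 (transp (matOf lo hi T)) := by
  have hpart : ∀ k i, part 0 (transp (matOf lo hi T)) k i =
      ∑ i' ∈ range k, matOf lo hi T (i', i) := fun k i => by
    simp [part, transp]
  constructor
  · intro h i l hV
    unfold Violates at hV
    rw [hpart, hpart, Finset.sum_range_succ] at hV
    have := h i (part lo (matOf lo hi T) (l + 1) i) l
    rw [lrCount_eq, lrCount_eq] at this
    have e1 : #{j' ∈ Ico (lo i) (hi i) | T i j' = l + 1 ∧ part lo (matOf lo hi T) (l + 1) i ≤ j'} =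
        matOf lo hi T (i, l + 1) := by
      show _ = #{j ∈ Ico (lo i) (hi i) | T i j = l + 1}
      congr 1
      refine Finset.filter_congr fun j' hj' => ?_
      rw [mem_Ico] at hj'
      have := hT.lt_iff hj'.1 hj'.2 (l + 1)
      omega
    have e2 : #{j' ∈ Ico (lo i) (hi i) | T i j' = l ∧ part lo (matOf lo hi T) (l + 1) i ≤ j'} = 0 := by
      rw [Finset.card_eq_zero, Finset.filter_eq_empty_iff]
      intro j' hj'
      rw [mem_Ico] at hj'
      have := hT.lt_iff hj'.1 hj'.2 (l + 1)
      omega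
    omega
  · intro h i j l
    rw [lrCount_eq, lrCount_eq]
    have h1 := h i l
    unfold Violates at h1
    rw [hpart, hpart, Finset.sum_range_succ] at h1
    have : #{j' ∈ Ico (lo i) (hi i) | T i j' = l + 1 ∧ j ≤ j'} ≤ matOf lo hi T (i, l + 1) :=
      Finset.card_le_card fun j' hj' => by
        rw [mem_filter] at hj' ⊢
        exact ⟨hj'.1, hj'.2.1⟩
    omega

theorem isLR_iff {lo hi : ℕ → ℕ} {T : ℕ → ℕ → ℕ} (hlo : Antitone lo) (hhi : Antitone hi)
    (hle : ∀ i, lo i ≤ hi i) :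
    IsLR hi lo T ↔ (∀ i j, ¬(lo i ≤ j ∧ j < hi i) → T i j = 0) ∧ RowWeak lo hi T ∧
      IsLRMat lo (matOf lo hi T) := by
  refine and_congr_right fun _ => and_congr_right fun (hT : RowWeak lo hi T) => ?_
  exact and_congr (hT.columnStrict_iff hlo hhi hle) hT.lattice_iff

theorem matOf_mem_mats {n : ℕ} {lo hi : ℕ → ℕ} {T : ℕ → ℕ → ℕ} (hhi : IsPart n hi)
    (hA : Semistd 0 (transp (matOf lo hi T))) :
    matOf lo hi T ∈ mats n (∑ i ∈ range n, rowSum n (matOf lo hi T) i) := by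
  refine mem_mats.2 ⟨rfl, fun i l h => ?_⟩
  have h0 : n ≤ i → matOf lo hi T (i, l) = 0 := fun h => by
    simp [matOf, hhi.2 i h]
  rcases h with h | h
  · exact h0 h
  · by_cases hi : n ≤ i
    · exact h0 hi
    · exact hA.apply_eq_zero (show i < l by omega)

theorem add_rowSum_matOf {n : ℕ} {lo hi : ℕ → ℕ} {T : ℕ → ℕ → ℕ} (hhi : IsPart n hi)
    (hle : ∀ i, lo i ≤ hi i) (hA : Semistd 0 (transp (matOf lo hi T))) (i : ℕ) :
    lo i + rowSum n (matOf lo hi T) i = hi i := by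
  rw [← part_eq, part_matOf]
  have h0 : ∀ j ∈ Ico (lo i) (hi i), T i j < n := fun j hj => by
    by_contra hn
    have hm := (mem_mats.1 (matOf_mem_mats hhi hA)).2 i (T i j) (Or.inr (by omega))
    unfold matOf at hm
    rw [Finset.card_eq_zero, Finset.filter_eq_empty_iff] at hm
    exact hm hj rfl
  rw [Finset.filter_true_of_mem h0, Nat.card_Ico]
  have := hle i
  omega

theorem part_le_of_mem_mats {n m : ℕ} (μ : ℕ → ℕ) {A : ℕ × ℕ → ℕ} (hA : A ∈ mats n m) (k i : ℕ) :
    part μ A k i ≤ μ i + rowSum n A i := by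
  rw [← part_eq]
  rcases le_total k n with h | h
  · exact part_mono μ A i h
  · unfold part
    rw [Finset.eventually_constant_sum (fun l hl => (mem_mats.1 hA).2 i l (Or.inr hl)) h]

theorem fillOf_lt_iff {n : ℕ} {lo hi : ℕ → ℕ} {A : ℕ × ℕ → ℕ}
    (hhi : ∀ i, lo i + rowSum n A i = hi i) {i j : ℕ} (h₁ : lo i ≤ j) (h₂ : j < hi i) (k : ℕ) :
    fillOf lo hi A i j < k ↔ j < part lo A k i := by
  unfold fillOf
  rw [if_pos ⟨h₁, h₂⟩]
  have hne : {k | j < part lo A (k + 1) i}.Nonempty :=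
    ⟨n, (h₂.trans_eq ((hhi i).symm)).trans_le (part_mono lo A i (Nat.le_succ n))⟩
  constructor
  · intro h
    have hmem : j < part lo A (sInf {k | j < part lo A (k + 1) i} + 1) i := Nat.sInf_mem hne
    exact hmem.trans_le (part_mono lo A i (Nat.succ_le_of_lt h))
  · intro h
    cases k with
    | zero => rw [part_zero] at h; omega
    | succ k => exact Nat.lt_succ_of_le (Nat.sInf_le h)

theorem rowWeak_fillOf {n : ℕ} {lo hi : ℕ → ℕ} {A : ℕ × ℕ → ℕ}
    (hhi : ∀ i, lo i + rowSum n A i = hi i) : RowWeak lo hi (fillOf lo hi A) := by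
  intro i j₁ j₂ h1 h2 h3
  rw [← Nat.lt_succ_iff, fillOf_lt_iff hhi h1 (by omega)]
  have := (fillOf_lt_iff hhi (h1.trans h2) h3 (fillOf lo hi A i j₂ + 1)).1 (Nat.lt_succ_self _)
  exact h2.trans_lt this

theorem matOf_fillOf {n m : ℕ} {lo hi : ℕ → ℕ} {A : ℕ × ℕ → ℕ} (hA : A ∈ mats n m)
    (hhi : ∀ i, lo i + rowSum n A i = hi i) : matOf lo hi (fillOf lo hi A) = A := by
  funext ⟨i, l⟩
  have : {j ∈ Ico (lo i) (hi i) | fillOf lo hi A i j = l} =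
      Ico (part lo A l i) (part lo A (l + 1) i) := by
    ext j
    rw [mem_filter, mem_Ico, mem_Ico]
    constructor
    · rintro ⟨⟨h1, h2⟩, h3⟩
      have e1 := fillOf_lt_iff hhi h1 h2 l
      have e2 := fillOf_lt_iff hhi h1 h2 (l + 1)
      omega
    · rintro ⟨h3, h4⟩
      have h1 : lo i ≤ j := le_trans (Nat.le_add_right _ _) h3
      have h2 : j < hi i := h4.trans_le ((part_le_of_mem_mats lo hA (l + 1) i).trans_eq (hhi i))
      have e1 := fillOf_lt_iff hhi h1 h2 l
      have e2 := fillOf_lt_iff hhi h1 h2 (l + 1)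
      exact ⟨⟨h1, h2⟩, by omega⟩
  unfold matOf
  rw [this, Nat.card_Ico, part_succ]
  omega

theorem fillOf_matOf {n : ℕ} {lo hi : ℕ → ℕ} {T : ℕ → ℕ → ℕ} (hhi : IsPart n hi)
    (hle : ∀ i, lo i ≤ hi i) (hT : RowWeak lo hi T) (h0 : ∀ i j, ¬(lo i ≤ j ∧ j < hi i) → T i j = 0)
    (hA : Semistd 0 (transp (matOf lo hi T))) : fillOf lo hi (matOf lo hi T) = T := by
  funext i j
  by_cases h : lo i ≤ j ∧ j < hi i
  · have h1 := fillOf_lt_iff (add_rowSum_matOf hhi hle hA) h.1 h.2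
    have h2 := hT.lt_iff h.1 h.2
    have h3 : ∀ k, fillOf lo hi (matOf lo hi T) i j < k ↔ T i j < k := fun k =>
      (h1 k).trans (h2 k).symm
    have h4 := h3 (T i j)
    have h5 := h3 (T i j + 1)
    omega
  · rw [h0 i j h, fillOf, if_neg h]

theorem skewContent_eq {n : ℕ} {lo hi : ℕ → ℕ} (hhi : IsPart n hi) (T : ℕ → ℕ → ℕ) :
    skewContent hi lo T = colSum n (matOf lo hi T) := by
  funext k
  unfold skewContent colSum matOf
  rw [← Finset.card_sigma, ← Nat.card_eq_finsetCard]
  refine Nat.card_congr ((Equiv.sigmaEquivProd ℕ ℕ).symm.subtypeEquiv fun p => ?_)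
  simp only [mem_sigma, mem_range, mem_filter, mem_Ico, Equiv.sigmaEquivProd_symm_apply]
  constructor
  · rintro ⟨h1, h2, h3⟩
    refine ⟨?_, ⟨h1, h2⟩, h3⟩
    by_contra h
    rw [hhi.2 _ (not_lt.1 h)] at h2
    omega
  · rintro ⟨-, ⟨h1, h2⟩, h3⟩
    exact ⟨h1, h2, h3⟩

theorem skewSize_eq {n : ℕ} {lo hi : ℕ → ℕ} (hhi : IsPart n hi) :
    skewSize hi lo = ∑ i ∈ range n, (hi i - lo i) := by
  unfold skewSize
  simp only [← Nat.card_Ico]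
  rw [← Finset.card_sigma, ← Nat.card_eq_finsetCard]
  refine Nat.card_congr ((Equiv.sigmaEquivProd ℕ ℕ).symm.subtypeEquiv fun p => ?_)
  simp only [mem_sigma, mem_range, mem_Ico, Equiv.sigmaEquivProd_symm_apply]
  constructor
  · rintro ⟨h1, h2⟩
    refine ⟨?_, h1, h2⟩
    by_contra h
    rw [hhi.2 _ (not_lt.1 h)] at h2
    omega
  · exact fun h => h.2

/-! ### Multitableaux and tuples of matrices -/

namespace LRMultiF

variable {n r : ℕ} {α : ℕ → ℕ}

def mat (M : LRMultiF r α) (k : Fin r) : ℕ × ℕ → ℕ :=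
  matOf (M.chain k.castSucc) (M.chain k.succ) (M.T k)

theorem isPart_chain (M : LRMultiF r α) (hα : IsPart n α) (k : Fin (r + 1)) :
    IsPart n (M.chain k) := by
  refine ⟨fun i j hij => M.antitone k i j hij, fun i hi => ?_⟩
  have hmono : Monotone fun k => M.chain k i := Fin.monotone_iff_le_succ.2 fun k => M.mono k i
  have h : M.chain k i ≤ M.chain (Fin.last r) i := hmono (Fin.le_last k)
  rw [M.last, hα.2 i hi] at h
  omega

theorem isLR_iff (M : LRMultiF r α) (hα : IsPart n α) (k : Fin r) :
    (∀ i j, ¬(M.chain k.castSucc i ≤ j ∧ j < M.chain k.succ i) → M.T k i j = 0) ∧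
      RowWeak (M.chain k.castSucc) (M.chain k.succ) (M.T k) ∧
      IsLRMat (M.chain k.castSucc) (M.mat k) :=
  (_root_.isLR_iff (M.isPart_chain hα _).1 (M.isPart_chain hα _).1 (M.mono k)).1 (M.lr k)

theorem chain_add_rowSum (M : LRMultiF r α) (hα : IsPart n α) (k : Fin r) (i : ℕ) :
    M.chain k.castSucc i + rowSum n (M.mat k) i = M.chain k.succ i :=
  add_rowSum_matOf (M.isPart_chain hα _) (M.mono k) (M.isLR_iff hα k).2.2.2 i

theorem size_eq (M : LRMultiF r α) (hα : IsPart n α) (k : Fin r) :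
    M.size k = ∑ i ∈ range n, rowSum n (M.mat k) i := by
  rw [size, skewSize_eq (M.isPart_chain hα _)]
  refine Finset.sum_congr rfl fun i _ => ?_
  rw [← M.chain_add_rowSum hα k i]
  omega

theorem mat_mem_mats (M : LRMultiF r α) (hα : IsPart n α) (k : Fin r) :
    M.mat k ∈ mats n (M.size k) := by
  rw [M.size_eq hα k]
  exact matOf_mem_mats (M.isPart_chain hα _) (M.isLR_iff hα k).2.2.2

theorem cont_eq (M : LRMultiF r α) (hα : IsPart n α) (k : Fin r) :
    M.cont k = colSum n (M.mat k) :=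
  skewContent_eq (M.isPart_chain hα _) _

theorem layer_mat (M : LRMultiF r α) (hα : IsPart n α) (k : Fin (r + 1)) :
    layer n 0 M.mat k = M.chain k := by
  induction k using Fin.induction with
  | zero =>
    funext i
    simp [M.zero]
  | succ k ih =>
    funext i
    rw [← M.chain_add_rowSum hα k i, ← ih]
    exact layer_succ n 0 M.mat k i

theorem isLRTuple_mat (M : LRMultiF r α) (hα : IsPart n α) : IsLRTuple n 0 M.mat := fun k => by
  have := (M.isLR_iff hα k).2.2
  rwa [← M.layer_mat hα k.castSucc] at this

theorem rowTot_mat (M : LRMultiF r α) (hα : IsPart n α) : rowTot n M.mat = α := by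
  funext i
  have h1 := layer_last n 0 M.mat i
  have h2 := congrFun (M.layer_mat hα (Fin.last r)) i
  rw [M.last, Fin.val_last] at h2
  rw [h2] at h1
  simpa using h1.symm

theorem mat_injective (hα : IsPart n α) : Function.Injective (mat : LRMultiF r α → _) := by
  intro M M' h
  have hc : M.chain = M'.chain := funext fun k => by
    rw [← M.layer_mat hα, ← M'.layer_mat hα, h]
  have hT : ∀ (M : LRMultiF r α) k, fillOf (M.chain k.castSucc) (M.chain k.succ) (M.mat k) = M.T k :=
    fun M k => fillOf_matOf (M.isPart_chain hα _) (M.mono k) (M.isLR_iff hα k).2.1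
      (M.isLR_iff hα k).1 (M.isLR_iff hα k).2.2.2
  have hT' : M.T = M'.T := funext fun k => by
    rw [← hT M k, ← hT M' k, h, hc]
  cases M
  cases M'
  cases hc
  cases hT'
  rfl

theorem exists_mat_eq {ν : Fin r → ℕ} {A : Fin r → ℕ × ℕ → ℕ} (hA : A ∈ tuples n ν)
    (hLR : IsLRTuple n 0 A) (hα : rowTot n A = α) : ∃ M : LRMultiF r α, M.mat = A := by
  have hp : ∀ k : Fin (r + 1), IsPart n (layer n 0 A k) := fun k =>
    hLR.isPart_layer (isPart_zero n) hA k (Nat.lt_succ_iff.1 k.2)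
  have hs : ∀ (k : Fin r) i, layer n 0 A k.castSucc i + rowSum n (A k) i = layer n 0 A k.succ i :=
    fun k i => (layer_succ n 0 A k i).symm
  have hmat : ∀ k : Fin r, matOf (layer n 0 A k.castSucc) (layer n 0 A k.succ)
      (fillOf (layer n 0 A k.castSucc) (layer n 0 A k.succ) (A k)) = A k := fun k =>
    matOf_fillOf (mem_tuples.1 hA k) (hs k)
  refine ⟨⟨fun k => layer n 0 A k, fun k i j hij => (hp k).1 hij, fun i => by simp, fun i => ?_,
    fun k i => ?_, fun k => fillOf (layer n 0 A k.castSucc) (layer n 0 A k.succ) (A k),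
    fun k => ?_⟩, funext hmat⟩
  · rw [Fin.val_last, layer_last, hα]; simp
  · rw [← hs]; omega
  · rw [_root_.isLR_iff (hp _).1 (hp _).1 fun i => by rw [← hs]; omega, hmat]
    refine ⟨fun i j h => ?_, rowWeak_fillOf (hs k), hLR k⟩
    rw [fillOf, if_neg h]

end LRMultiF

theorem lrNum_eq_card {n r : ℕ} {a b : ℕ → ℕ} (ha : IsPart n a) (hb : IsPart n b) (ν : Fin r → ℕ) :
    lrNum r a b ν =
      #{p ∈ tuples n ν ×ˢ tuples n ν | (IsLRTuple n 0 p.1 ∧ rowTot n p.1 = a) ∧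
        (IsLRTuple n 0 p.2 ∧ rowTot n p.2 = b) ∧ ∀ k, colSum n (p.1 k) = colSum n (p.2 k)} := by
  rw [← Nat.card_eq_finsetCard]
  refine Nat.card_congr (Equiv.ofBijective (fun TS => ⟨(TS.1.1.mat, TS.1.2.mat), ?_⟩) ⟨?_, ?_⟩)
  · obtain ⟨⟨M, N⟩, hM, hN, hc⟩ := TS
    refine mem_filter.2 ⟨mem_product.2 ⟨mem_tuples.2 fun k => ?_, mem_tuples.2 fun k => ?_⟩,
      ⟨M.isLRTuple_mat ha, M.rowTot_mat ha⟩, ⟨N.isLRTuple_mat hb, N.rowTot_mat hb⟩, fun k => ?_⟩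
    · exact hM k ▸ M.mat_mem_mats ha k
    · exact hN k ▸ N.mat_mem_mats hb k
    · rw [← M.cont_eq ha, ← N.cont_eq hb]
      exact hc k
  · rintro ⟨⟨M, N⟩, h⟩ ⟨⟨M', N'⟩, h'⟩ heq
    simp only [Subtype.mk.injEq, Prod.mk.injEq] at heq
    exact Subtype.ext
      (Prod.ext (LRMultiF.mat_injective ha heq.1) (LRMultiF.mat_injective hb heq.2))
  · rintro ⟨⟨A, B⟩, h⟩
    obtain ⟨hAB, ⟨hA, hA'⟩, ⟨hB, hB'⟩, hc⟩ := mem_filter.1 h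
    obtain ⟨hAt, hBt⟩ := mem_product.1 hAB
    obtain ⟨M, hM⟩ := LRMultiF.exists_mat_eq hAt hA hA'
    obtain ⟨N, hN⟩ := LRMultiF.exists_mat_eq hBt hB hB'
    simp only at hM hN hc
    refine ⟨⟨⟨M, N⟩, fun k => ?_, fun k => ?_, fun k => ?_⟩, ?_⟩
    · rw [M.size_eq ha, hM]
      exact (mem_mats.1 (mem_tuples.1 hAt k)).1
    · rw [N.size_eq hb, hN]
      exact (mem_mats.1 (mem_tuples.1 hBt k)).1
    · simp only [M.cont_eq ha, N.cont_eq hb, hM, hN, hc k]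
    · simp only [hM, hN]

/-! ### Counting colorings fixed by permutations -/

/-- The number of points of each color. -/
def colorCount {n r : ℕ} (F : Fin n → (ℕ × ℕ) × Fin r) (k : Fin r) : ℕ × ℕ → ℕ := fun p =>
  #{x | F x = (p, k)}

def colorings (n r : ℕ) : Finset (Fin n → (ℕ × ℕ) × Fin r) :=
  Fintype.piFinset fun _ => (range n ×ˢ range n) ×ˢ univ

theorem mem_colorings {n r : ℕ} {F : Fin n → (ℕ × ℕ) × Fin r} :
    F ∈ colorings n r ↔ ∀ x, (F x).1.1 < n ∧ (F x).1.2 < n := by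
  simp [colorings]

theorem comp_mem_colorings {n r : ℕ} {F : Fin n → (ℕ × ℕ) × Fin r} (hF : F ∈ colorings n r)
    (h : Perm (Fin n)) : F ∘ h ∈ colorings n r :=
  mem_colorings.2 fun x => mem_colorings.1 hF (h x)

theorem colorCount_comp {n r : ℕ} (F : Fin n → (ℕ × ℕ) × Fin r) (h : Perm (Fin n)) :
    colorCount (F ∘ h) = colorCount F := by
  funext k p
  exact Finset.card_equiv h fun x => by simp

theorem exists_comp_eq {n r : ℕ} {F F' : Fin n → (ℕ × ℕ) × Fin r}
    (hF : colorCount F = colorCount F') : ∃ h : Perm (Fin n), F ∘ h = F' := by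
  have he : ∀ z, Nonempty ({x // F' x = z} ≃ {x // F x = z}) := fun z => by
    rw [← Fintype.card_eq, Fintype.card_subtype, Fintype.card_subtype]
    exact (congrFun (congrFun hF z.2) z.1).symm
  let e := fun z => (he z).some
  refine ⟨(Equiv.sigmaFiberEquiv F').symm.trans
    ((Equiv.sigmaCongrRight e).trans (Equiv.sigmaFiberEquiv F)), funext fun x => ?_⟩
  exact (e (F' x) ⟨x, rfl⟩).2

theorem exists_colorCount_eq {n r : ℕ} {ν : Fin r → ℕ} (hν : ∑ k, ν k = n)
    {A : Fin r → ℕ × ℕ → ℕ} (hA : A ∈ tuples n ν) : ∃ F ∈ colorings n r, colorCount F = A := by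
  let S : Finset ((ℕ × ℕ) × Fin r) := (range n ×ˢ range n) ×ˢ univ
  have hcard : Fintype.card (Σ z : S, Fin (A z.1.2 z.1.1)) = n := by
    rw [Fintype.card_sigma]
    simp only [Fintype.card_fin]
    rw [Finset.sum_coe_sort S fun z => A z.2 z.1, Finset.sum_product_right]
    refine Eq.trans (Finset.sum_congr rfl fun k _ => ?_) hν
    rw [Finset.sum_product]
    exact (mem_mats.1 (mem_tuples.1 hA k)).1
  let e := (Fintype.equivFinOfCardEq hcard).symm
  have hmem : ∀ x, ((e x).1.1).1.1 < n ∧ ((e x).1.1).1.2 < n := fun x => by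
    have := (mem_product.1 (mem_product.1 (e x).1.2).1)
    exact ⟨mem_range.1 this.1, mem_range.1 this.2⟩
  refine ⟨fun x => (e x).1.1, mem_colorings.2 hmem, ?_⟩
  funext k p
  unfold colorCount
  by_cases hp : p.1 < n ∧ p.2 < n
  · have hz : (p, k) ∈ S := by simpa [S] using hp
    rw [← Fintype.card_subtype, ← Fintype.card_fin (A k p)]
    refine Fintype.card_congr ((e.subtypeEquiv fun x => ?_).trans
      (Equiv.sigmaSubtype (β := fun z : S => Fin (A z.1.2 z.1.1)) ⟨(p, k), hz⟩))
    simp [Subtype.ext_iff]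
  · rw [(mem_mats.1 (mem_tuples.1 hA k)).2 p.1 p.2 (by omega), Finset.card_eq_zero,
      Finset.filter_eq_empty_iff]
    intro x _ hx
    have := hmem x
    simp only at hx
    rw [hx] at this
    exact hp this

theorem sum_card_stabilizer {n r : ℕ} {ν : Fin r → ℕ} (hν : ∑ k, ν k = n)
    {A : Fin r → ℕ × ℕ → ℕ} (hA : A ∈ tuples n ν) :
    ∑ F ∈ colorings n r with colorCount F = A, #{g : Perm (Fin n) | F ∘ g = F} = n.factorial := by
  obtain ⟨F₀, hF₀, rfl⟩ := exists_colorCount_eq hν hA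
  have h1 : ∀ F ∈ (colorings n r).filter fun F => colorCount F = colorCount F₀,
      #{g : Perm (Fin n) | F ∘ g = F} = #{h : Perm (Fin n) | F₀ ∘ h = F} := fun F hF => by
    obtain ⟨h, rfl⟩ := exists_comp_eq (mem_filter.1 hF).2.symm
    exact Finset.card_equiv (Equiv.mulLeft h) fun g => by simp [Perm.coe_mul, Function.comp_assoc]
  rw [Finset.sum_congr rfl h1, ← Finset.card_eq_sum_card_fiberwise, Finset.card_univ,
    Fintype.card_perm, Fintype.card_fin]
  intro h _
  exact mem_filter.2 ⟨comp_mem_colorings hF₀ h, colorCount_comp F₀ h⟩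

theorem rowTot_colorCount {n r : ℕ} {F : Fin n → (ℕ × ℕ) × Fin r} (hF : F ∈ colorings n r) (i : ℕ) :
    rowTot n (colorCount F) i = #{x | (F x).1.1 = i} := by
  unfold rowTot rowSum colorCount
  rw [← Finset.sum_product', Finset.card_eq_sum_card_fiberwise (f := fun x => ((F x).2, (F x).1.2))
    (t := univ ×ˢ range n)]
  · refine Finset.sum_congr rfl fun z _ => ?_
    rw [filter_filter]
    congr 1
    ext x
    simp only [mem_filter, mem_univ, true_and, Prod.ext_iff]
    tauto
  · intro x _
    simpa using (mem_colorings.1 hF x).2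

theorem colTot_colorCount {n r : ℕ} {F : Fin n → (ℕ × ℕ) × Fin r} (hF : F ∈ colorings n r) (i : ℕ) :
    colTot n (colorCount F) i = #{x | (F x).1.2 = i} := by
  unfold colTot colSum colorCount
  rw [← Finset.sum_product', Finset.card_eq_sum_card_fiberwise (f := fun x => ((F x).2, (F x).1.1))
    (t := univ ×ˢ range n)]
  · refine Finset.sum_congr rfl fun z _ => ?_
    rw [filter_filter]
    congr 1
    ext x
    simp only [mem_filter, mem_univ, true_and, Prod.ext_iff]
    tauto
  · intro x _
    simpa using (mem_colorings.1 hF x).1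

theorem sum_rowSum_colorCount {n r : ℕ} {F : Fin n → (ℕ × ℕ) × Fin r} (hF : F ∈ colorings n r)
    (k : Fin r) : ∑ i ∈ range n, rowSum n (colorCount F k) i = #{x | (F x).2 = k} := by
  unfold rowSum colorCount
  rw [← Finset.sum_product', Finset.card_eq_sum_card_fiberwise (f := fun x => (F x).1)
    (t := range n ×ˢ range n)]
  · refine Finset.sum_congr rfl fun z _ => ?_
    rw [filter_filter]
    congr 1
    ext x
    simp only [mem_filter, mem_univ, true_and, Prod.ext_iff]
    tauto
  · intro x _
    simpa using mem_colorings.1 hF x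

theorem colorCount_mem_tuples {n r : ℕ} {ν : Fin r → ℕ} {F : Fin n → (ℕ × ℕ) × Fin r}
    (hF : F ∈ colorings n r) :
    colorCount F ∈ tuples n ν ↔ ∀ k, #{x | (F x).2 = k} = ν k := by
  simp only [mem_tuples, mem_mats, sum_rowSum_colorCount hF]
  refine forall_congr' fun k => and_iff_left fun i l h => ?_
  rw [colorCount, Finset.card_eq_zero, Finset.filter_eq_empty_iff]
  intro x _ hx
  have := mem_colorings.1 hF x
  rw [hx] at this
  simp only at this
  omega

theorem natCard_fiber {n : ℕ} {C : Type*} [DecidableEq C] (f : Fin n → C) (k : C) :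
    Nat.card {x : Fin n // f x = k} = #{x | f x = k} := by
  rw [Nat.card_eq_fintype_card, Fintype.card_subtype]

theorem mem_colorings_filter {n r : ℕ} {ν : Fin r → ℕ} {c d : ℕ → ℕ}
    {F : Fin n → (ℕ × ℕ) × Fin r} (hF : F ∈ colorings n r) :
    (colorCount F ∈ tuples n ν ∧ rowTot n (colorCount F) = c ∧ colTot n (colorCount F) = d) ↔
      (∀ k, #{x | (F x).2 = k} = ν k) ∧ (∀ i, #{x | (F x).1.1 = i} = c i) ∧
        ∀ i, #{x | (F x).1.2 = i} = d i := by
  simp only [colorCount_mem_tuples hF, funext_iff, rowTot_colorCount hF, colTot_colorCount hF]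

theorem lt_of_card_fiber {n p : ℕ} {f : Fin n → ℕ} {c : ℕ → ℕ} (hc : ∀ i, p ≤ i → c i = 0)
    (hf : ∀ k, #{x | f x = k} = c k) (x : Fin n) : f x < p := by
  by_contra h
  have := hf (f x)
  rw [hc _ (not_lt.1 h), Finset.card_eq_zero, Finset.filter_eq_empty_iff] at this
  exact this (mem_univ x) rfl

theorem permChar_mul_mul {n r : ℕ} (ν : Fin r → ℕ) {c d : ℕ → ℕ} (hc : ∀ i, n ≤ i → c i = 0)
    (hd : ∀ i, n ≤ i → d i = 0) (g : Perm (Fin n)) :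
    permChar n c g * permChar n d g * permChar n (extc ν) g =
      #{F ∈ colorings n r | (colorCount F ∈ tuples n ν ∧ rowTot n (colorCount F) = c ∧
        colTot n (colorCount F) = d) ∧ F ∘ g = F} := by
  unfold permChar
  rw [← Nat.cast_mul, ← Nat.cast_mul, ← Nat.card_prod, ← Nat.card_prod, ← Nat.card_eq_finsetCard]
  congr 1
  simp only [natCard_fiber]
  set S := {F ∈ colorings n r | (colorCount F ∈ tuples n ν ∧ rowTot n (colorCount F) = c ∧
    colTot n (colorCount F) = d) ∧ F ∘ g = F} with hS
  have hrow : ∀ F : S, (∀ k, #{x | (F.1 x).1.1 = k} = c k) ∧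
      ∀ x, (F.1 (g x)).1.1 = (F.1 x).1.1 := fun F => by
    obtain ⟨hF, hF', hg⟩ := mem_filter.1 F.2
    have h := (mem_colorings_filter hF).1 hF'
    exact ⟨h.2.1, fun x => congrArg (fun z => z.1.1) (congrFun hg x)⟩
  have hcol : ∀ F : S, (∀ k, #{x | (F.1 x).1.2 = k} = d k) ∧
      ∀ x, (F.1 (g x)).1.2 = (F.1 x).1.2 := fun F => by
    obtain ⟨hF, hF', hg⟩ := mem_filter.1 F.2
    have h := (mem_colorings_filter hF).1 hF'
    exact ⟨h.2.2, fun x => congrArg (fun z => z.1.2) (congrFun hg x)⟩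
  have hidx : ∀ F : S, (∀ k, #{x | ((F.1 x).2 : ℕ) = k} = extc ν k) ∧
      ∀ x, ((F.1 (g x)).2 : ℕ) = (F.1 x).2 := fun F => by
    obtain ⟨hF, hF', hg⟩ := mem_filter.1 F.2
    have h := (mem_colorings_filter hF).1 hF'
    refine ⟨fun k => ?_, fun x => congrArg (fun z => (z.2 : ℕ)) (congrFun hg x)⟩
    unfold extc
    split_ifs with hk
    · rw [← h.1 ⟨k, hk⟩]
      simp only [Fin.ext_iff]
    · rw [Finset.card_eq_zero, Finset.filter_eq_empty_iff]
      intro x _ hx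
      exact hk (hx ▸ (F.1 x).2.2)
  refine (Nat.card_congr (Equiv.ofBijective (fun F : S => ((⟨fun x => (F.1 x).1.1, hrow F⟩,
    ⟨fun x => (F.1 x).1.2, hcol F⟩), ⟨fun x => (F.1 x).2, hidx F⟩)) ⟨?_, ?_⟩)).symm
  · rintro ⟨F, hF⟩ ⟨F', hF'⟩ h
    simp only [Prod.mk.injEq, Subtype.mk.injEq, funext_iff] at h
    exact Subtype.ext (funext fun x => Prod.ext (Prod.ext (h.1.1 x) (h.1.2 x)) (Fin.ext (h.2 x)))
  · rintro ⟨⟨⟨f₁, h₁, h₁'⟩, ⟨f₂, h₂, h₂'⟩⟩, ⟨f₃, h₃, h₃'⟩⟩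
    have hlt : ∀ x, f₃ x < r :=
      lt_of_card_fiber (c := extc ν) (fun i hi => dif_neg (not_lt.2 hi)) h₃
    have hF : (fun x => ((f₁ x, f₂ x), ⟨f₃ x, hlt x⟩) : Fin n → (ℕ × ℕ) × Fin r) ∈ colorings n r :=
      mem_colorings.2 fun x => ⟨lt_of_card_fiber hc h₁ x, lt_of_card_fiber hd h₂ x⟩
    refine ⟨⟨_, mem_filter.2 ⟨hF, (mem_colorings_filter hF).2 ⟨fun k => ?_, h₁, h₂⟩, ?_⟩⟩, rfl⟩
    · have := h₃ k
      simp only [extc, k.2, dif_pos] at this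
      simp only [Fin.ext_iff, this]
    · funext x
      simp only [Function.comp, h₁', h₂', h₃']

theorem sum_permChar {n r : ℕ} {ν : Fin r → ℕ} (hν : ∑ k, ν k = n) {c d : ℕ → ℕ}
    (hc : ∀ i, n ≤ i → c i = 0) (hd : ∀ i, n ≤ i → d i = 0) :
    ∑ g, permChar n c g * permChar n d g * permChar n (extc ν) g =
      n.factorial * #{A ∈ tuples n ν | rowTot n A = c ∧ colTot n A = d} := by
  simp only [permChar_mul_mul ν hc hd]
  rw [← Nat.cast_sum, ← Nat.cast_mul]
  congr 1
  set P : (Fin r → ℕ × ℕ → ℕ) → Prop := fun A => A ∈ tuples n ν ∧ rowTot n A = c ∧ colTot n A = d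
    with hP
  have h1 : ∀ g : Perm (Fin n), #{F ∈ colorings n r | P (colorCount F) ∧ F ∘ g = F} =
      ∑ F ∈ colorings n r with P (colorCount F), if F ∘ g = F then 1 else 0 := fun g => by
    rw [← Finset.filter_filter, Finset.card_filter]
  refine (Finset.sum_congr rfl fun g _ => h1 g).trans ?_
  rw [Finset.sum_comm, ← Finset.sum_fiberwise_of_maps_to (g := colorCount)
    (t := {A ∈ tuples n ν | rowTot n A = c ∧ colTot n A = d})
    fun F hF => mem_filter.2 (mem_filter.1 hF).2, mul_comm, ← smul_eq_mul, ← Finset.sum_const]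
  refine Finset.sum_congr rfl fun A hA => ?_
  rw [← sum_card_stabilizer hν (mem_filter.1 hA).1, Finset.filter_filter]
  refine Finset.sum_congr (Finset.filter_congr fun F _ => and_iff_right_of_imp ?_) fun F _ =>
    (Finset.card_filter _ _).symm
  rintro rfl
  exact mem_filter.1 hA

/-- The composition indexing the term of `σ` in the Jacobi–Trudi expansion. -/
def jtVec (n : ℕ) (a : ℕ → ℕ) (σ : Perm (Fin n)) : ℕ → ℤ :=
  fun i => if h : i < n then (a i : ℤ) - i + ((σ ⟨i, h⟩ : Fin n) : ℕ) else 0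

theorem irrChar_eq (n : ℕ) (a : ℕ → ℕ) (g : Perm (Fin n)) :
    irrChar n a g = ∑ σ : Perm (Fin n), ((Perm.sign σ : ℤ) : ℚ) * permCharZ n (jtVec n a σ) g := rfl

theorem sum_permCharZ {n r : ℕ} {ν : Fin r → ℕ} (hν : ∑ k, ν k = n) {u w : ℕ → ℤ}
    (hu : ∀ i, n ≤ i → u i = 0) (hw : ∀ i, n ≤ i → w i = 0) :
    ∑ g, permCharZ n u g * permCharZ n w g * permChar n (extc ν) g = n.factorial *
      #{A ∈ tuples n ν | (∀ i, (rowTot n A i : ℤ) = u i) ∧ ∀ i, (colTot n A i : ℤ) = w i} := by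
  by_cases h : (∀ i, 0 ≤ u i) ∧ ∀ i, 0 ≤ w i
  · simp only [permCharZ, if_pos h.1, if_pos h.2]
    rw [sum_permChar hν (fun i hi => by rw [hu i hi]; rfl) (fun i hi => by rw [hw i hi]; rfl)]
    have he : ∀ (x : ℕ → ℕ) (v : ℕ → ℤ), (∀ i, 0 ≤ v i) →
        ((x = fun i => (v i).toNat) ↔ ∀ i, (x i : ℤ) = v i) := fun x v hv => by
      rw [funext_iff]
      refine forall_congr' fun i => ?_
      have := hv i
      omega
    simp only [he _ _ h.1, he _ _ h.2]
  · have h0 : ∀ g, permCharZ n u g * permCharZ n w g = 0 := fun g => by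
      rcases not_and_or.1 h with h | h <;> simp [permCharZ, h]
    rw [Finset.filter_false_of_mem]
    · simp [h0]
    · rintro A - ⟨hA, hA'⟩
      exact h ⟨fun i => hA i ▸ Int.natCast_nonneg _, fun i => hA' i ▸ Int.natCast_nonneg _⟩

theorem shift_eq_iff_jtVec {n : ℕ} {x : ℕ → ℕ} (hx : ∀ i, n ≤ i → x i = 0) (a : ℕ → ℕ)
    (σ : Perm (Fin n)) : (∀ i : Fin n, shift x (σ i : ℕ) = shift a i) ↔
      ∀ i, (((x ∘ extPerm σ) i : ℕ) : ℤ) = jtVec n a σ i := by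
  constructor
  · intro h i
    unfold jtVec
    split_ifs with hi
    · have := h ⟨i, hi⟩
      have he := extPerm_coe σ ⟨i, hi⟩
      simp only [shift] at this he
      simp only [Function.comp, he]
      omega
    · rw [Function.comp, extPerm_fixes σ i (not_lt.1 hi), hx i (not_lt.1 hi), Nat.cast_zero]
  · intro h i
    have := h i
    simp only [jtVec, Function.comp, extPerm_coe] at this
    rw [dif_pos i.2] at this
    simp only [Fin.eta] at this
    simp only [shift]
    omega

theorem card_jtVec {n r : ℕ} (ν : Fin r → ℕ) (a b : ℕ → ℕ) (σ τ : Perm (Fin n)) :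
    (#{A ∈ tuples n ν | (∀ i, (rowTot n A i : ℤ) = jtVec n a σ i) ∧
      ∀ i, (colTot n A i : ℤ) = jtVec n b τ i} : ℤ) =
    ∑ A ∈ tuples n ν, (if ∀ i : Fin n, shift (rowTot n A) (σ i : ℕ) = shift a i then 1 else 0) *
      if ∀ i : Fin n, shift (colTot n A) (τ i : ℕ) = shift b i then 1 else 0 := by
  rw [Finset.natCast_card_filter]
  refine (sum_tuples_permute n ν (extPerm_fixes σ) (extPerm_fixes τ) fun x y =>
    if (∀ i, (x i : ℤ) = jtVec n a σ i) ∧ ∀ i, (y i : ℤ) = jtVec n b τ i then (1 : ℤ) else 0).symm.trans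
    (Finset.sum_congr rfl fun A hA => ?_)
  have hr : ∀ i, n ≤ i → rowTot n A i = 0 := fun i hi =>
    Finset.sum_eq_zero fun k _ => rowSum_eq_zero (mem_tuples.1 hA k) hi
  have hc : ∀ i, n ≤ i → colTot n A i = 0 := fun i hi =>
    Finset.sum_eq_zero fun k _ => colSum_eq_zero (mem_tuples.1 hA k) hi
  simp only [shift_eq_iff_jtVec hr, shift_eq_iff_jtVec hc, mul_ite, mul_one, mul_zero, ite_and]
  split_ifs <;> rfl

theorem sum_altSign_eq {n r : ℕ} (ν : Fin r → ℕ) (a b : ℕ → ℕ) :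
    ∑ A ∈ tuples n ν, altSign n (shift a) (shift (rowTot n A)) *
      altSign n (shift b) (shift (colTot n A)) =
    ∑ σ : Perm (Fin n), ∑ τ : Perm (Fin n), (Perm.sign σ : ℤ) * (Perm.sign τ : ℤ) *
      (#{A ∈ tuples n ν | (∀ i, (rowTot n A i : ℤ) = jtVec n a σ i) ∧
        ∀ i, (colTot n A i : ℤ) = jtVec n b τ i} : ℤ) := by
  simp only [altSign, Finset.sum_mul_sum]
  simp only [card_jtVec, Finset.mul_sum]
  rw [Finset.sum_comm]
  refine Finset.sum_congr rfl fun σ _ => ?_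
  rw [Finset.sum_comm]
  exact Finset.sum_congr rfl fun τ _ => Finset.sum_congr rfl fun A _ => mul_mul_mul_comm _ _ _ _

theorem innerChar_irrChar {n r : ℕ} {ν : Fin r → ℕ} (hν : ∑ k, ν k = n) (a b : ℕ → ℕ) :
    innerChar n (fun g => irrChar n a g * irrChar n b g * permChar n (extc ν) g) (trivChar n) =
      ((∑ A ∈ tuples n ν, altSign n (shift a) (shift (rowTot n A)) *
        altSign n (shift b) (shift (colTot n A)) : ℤ) : ℚ) := by
  have hj : ∀ (a : ℕ → ℕ) (σ : Perm (Fin n)) i, n ≤ i → jtVec n a σ i = 0 := fun a σ i hi =>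
    dif_neg (not_lt.2 hi)
  rw [innerChar, div_eq_iff (Nat.cast_ne_zero.2 n.factorial_ne_zero), sum_altSign_eq]
  simp only [trivChar, mul_one, irrChar_eq, Finset.sum_mul_sum]
  simp only [Finset.sum_mul]
  push_cast
  rw [Finset.sum_comm, Finset.sum_mul]
  refine Finset.sum_congr rfl fun σ _ => ?_
  rw [Finset.sum_comm, Finset.sum_mul]
  refine Finset.sum_congr rfl fun τ _ => ?_
  rw [mul_assoc, mul_comm (Nat.cast _ : ℚ), ← sum_permCharZ hν (hj a σ) (hj b τ), Finset.mul_sum]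
  exact Finset.sum_congr rfl fun g _ => by ring

theorem IsPartitionFun.isPart {n : ℕ} {a : ℕ → ℕ} (ha : IsPartitionFun n a) : IsPart n a :=
  ⟨fun i j h => ha.1 i j h, ha.2.1⟩

/-- `lr(a,b;ν) = ⟨χ^a ⊗ χ^b ⊗ φ^ν, χ^{(n)}⟩`. -/
theorem stmt8 (n r : ℕ) (a b : ℕ → ℕ) (ha : IsPartitionFun n a) (hb : IsPartitionFun n b)
    (ν : Fin r → ℕ) (hν : ∑ k, ν k = n) :
    (lrNum r a b ν : ℚ) =
      innerChar n (fun g => irrChar n a g * irrChar n b g * permChar n (extc ν) g)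
        (trivChar n) := by
  rw [innerChar_irrChar hν, sum_tuples_altSign ν ha.isPart hb.isPart,
    lrNum_eq_card ha.isPart hb.isPart ν, Int.cast_natCast]
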